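/- Fix η with η* ≤ η < 1, where η* = (W(2/e)/(2/e))^{3/2}. Then for every c > 0 the limit φ_η(c) = lim_{n→∞} n^{-3/2}·log P_{c/√n}( X ≤ η·E X ) exists (using the edge probability min(1, c/√n)), and the function c ↦ φ_η(c) is real-analytic at every point of (0,∞). -/

import Mathlib

open Filter
open scoped BigOperators symmDiff Classical

noncomputable section

/-- Number of edges of a labeled simple graph on `Fin n`. -/
def edgeCount {n : ℕ} (G : SimpleGraph (Fin n)) : ℕ := Nat.card G.edgeSet

/-- Number of triangles of a labeled simple graph on `Fin n`. -/
def triCount {n : ℕ} (G : SimpleGraph (Fin n)) : ℕ :=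
  Nat.card {s : Finset (Fin n) // G.IsNClique 3 s}

/-- Probability of the event `A` under the Erdős–Rényi random graph `G(n,p)`. -/
def erProb (n : ℕ) (p : ℝ) (A : Set (SimpleGraph (Fin n))) : ℝ :=
  ∑ G : SimpleGraph (Fin n),
    if G ∈ A then p ^ edgeCount G * (1 - p) ^ (n.choose 2 - edgeCount G) else 0

/-- Conditional probability `P_p(A | B)` for `G(n,p)`. -/
def erCondProb (n : ℕ) (p : ℝ) (A B : Set (SimpleGraph (Fin n))) : ℝ :=
  erProb n p (A ∩ B) / erProb n p B

/-- Probability of the event `A` under the uniform random graph `G(n,m)`. -/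
def gnmProb (n m : ℕ) (A : Set (SimpleGraph (Fin n))) : ℝ :=
  (Nat.card {G : SimpleGraph (Fin n) // edgeCount G = m ∧ G ∈ A} : ℝ) /
    ((n.choose 2).choose m : ℝ)

/-- Expected number of triangles of `G(n,m)`. -/
def gnmExpTri (n m : ℕ) : ℝ :=
  (∑ G : SimpleGraph (Fin n), if edgeCount G = m then (triCount G : ℝ) else 0) /
    ((n.choose 2).choose m : ℝ)

/-- Gibbs weight `λ^{|G|} (1-ζ)^{X(G)}`. -/
def gibbsWeight {n : ℕ} (lam zeta : ℝ) (G : SimpleGraph (Fin n)) : ℝ :=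
  lam ^ edgeCount G * (1 - zeta) ^ triCount G

/-- The partition function `Z(λ,ζ)`. -/
def Zfun (n : ℕ) (lam zeta : ℝ) : ℝ := ∑ G : SimpleGraph (Fin n), gibbsWeight lam zeta G

/-- Probability of the event `A` under the Gibbs measure `μ_{λ,ζ}`. -/
def gibbsProb (n : ℕ) (lam zeta : ℝ) (A : Set (SimpleGraph (Fin n))) : ℝ :=
  (∑ G : SimpleGraph (Fin n), if G ∈ A then gibbsWeight lam zeta G else 0) / Zfun n lam zeta

/-- Expectation of `f` under the Gibbs measure `μ_{λ,ζ}`. -/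
def gibbsExp (n : ℕ) (lam zeta : ℝ) (f : SimpleGraph (Fin n) → ℝ) : ℝ :=
  (∑ G : SimpleGraph (Fin n), f G * gibbsWeight lam zeta G) / Zfun n lam zeta

/-- Number of edges of `H` with both endpoints in `S`. -/
def edgesIn {V : Type*} (H : SimpleGraph V) (S : Finset V) : ℕ :=
  Nat.card {e : Sym2 V // e ∈ H.edgeSet ∧ ∀ v ∈ e, v ∈ S}

/-- Weight `λ^{|S|} (1-ζ)^{|E(S)|}` of the measure `ν_{H,λ,ζ}`. -/
def nuWeight {V : Type*} (H : SimpleGraph V) (lam zeta : ℝ) (S : Finset V) : ℝ :=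
  lam ^ S.card * (1 - zeta) ^ edgesIn H S

/-- The partition function `Ξ_H(λ,ζ)`. -/
def XiFun {V : Type*} [Fintype V] (H : SimpleGraph V) (lam zeta : ℝ) : ℝ :=
  ∑ S : Finset V, nuWeight H lam zeta S

/-- The probability of `S` under `ν_{H,λ,ζ}`. -/
def nuProb {V : Type*} [Fintype V] (H : SimpleGraph V) (lam zeta : ℝ) (S : Finset V) : ℝ :=
  nuWeight H lam zeta S / XiFun H lam zeta

/-- `W` is the Lambert-W function on `[0,∞)`: for `x ≥ 0`, `W x` is the unique `w ≥ 0`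
with `w·e^w = x`. -/
def IsLambertW (W : ℝ → ℝ) : Prop :=
  ∀ x : ℝ, 0 ≤ x → (0 ≤ W x ∧ W x * Real.exp (W x) = x ∧
    ∀ w : ℝ, 0 ≤ w → w * Real.exp w = x → w = W x)

/-- `η* = (W(2/e)/(2/e))^{3/2}`. -/
def etaStar (W : ℝ → ℝ) : ℝ := (W (2 / Real.exp 1) / (2 / Real.exp 1)) ^ ((3 : ℝ) / 2)

/-- The condition `c < c̄(η)` where `c̄(η) = 1/√(e(1−η/η*))` for `η < η*` and `+∞` otherwise. -/
def LtCbar (W : ℝ → ℝ) (c η : ℝ) : Prop :=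
  η < etaStar W → c < 1 / Real.sqrt (Real.exp 1 * (1 - η / etaStar W))

/-- The left-hand side of the equation defining `ζ(c,η)`, interpreted as `1` at `ζ = 0`. -/
def zetaLHS (W : ℝ → ℝ) (c zeta : ℝ) : ℝ :=
  (1 - zeta) * (if zeta = 0 then 1 else
    (W (2 * zeta * c ^ 2) / (2 * zeta * c ^ 2)) ^ ((3 : ℝ) / 2))

/-- The partition function of the random sets `S ⊇ P` with weight
`lam ^ |S| * (1 - zeta) ^ #{T ∈ H | T ⊆ S}`. -/
def pinnedZ {E : Type*} [Fintype E] [DecidableEq E] (lam zeta : ℝ) (H : Finset (Finset E))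
    (P : Finset E) : ℝ :=
  ∑ S : Finset E with P ⊆ S, lam ^ S.card * (1 - zeta) ^ (H.filter (· ⊆ S)).card

/-- The probability that `e ∈ S` under the measure normalised by `pinnedZ lam zeta H P`. -/
def occ {E : Type*} [Fintype E] [DecidableEq E] (lam zeta : ℝ) (H : Finset (Finset E))
    (P : Finset E) (e : E) : ℝ :=
  pinnedZ lam zeta H (insert e P) / pinnedZ lam zeta H P

section Pinned

variable {E : Type*} [Fintype E] [DecidableEq E] {lam zeta : ℝ}

lemma pinnedZ_pos (hl : 0 < lam) (hz : zeta < 1) (H : Finset (Finset E)) (P : Finset E) :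
    0 < pinnedZ lam zeta H P := by
  have h1 : 0 < 1 - zeta := by linarith
  refine Finset.sum_pos (fun S _ => by positivity) ⟨Finset.univ, by simp⟩

lemma pinnedZ_antitone (hl : 0 < lam) (hz : zeta < 1) (H : Finset (Finset E)) {P Q : Finset E}
    (h : P ⊆ Q) : pinnedZ lam zeta H Q ≤ pinnedZ lam zeta H P := by
  have h1 : 0 < 1 - zeta := by linarith
  refine Finset.sum_le_sum_of_subset_of_nonneg ?_ (fun S _ _ => by positivity)
  intro S
  simp only [Finset.mem_filter, Finset.mem_univ, true_and]
  exact h.trans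

lemma pinnedZ_split (hl : lam ≠ 0) (H : Finset (Finset E)) {P : Finset E} {e : E} (he : e ∉ P) :
    pinnedZ lam zeta H P = pinnedZ lam zeta H (insert e P) +
      lam⁻¹ * pinnedZ lam zeta (H.filter (e ∉ ·)) (insert e P) := by
  unfold pinnedZ
  rw [← Finset.sum_filter_add_sum_filter_not _ (fun S => e ∈ S)]
  congr 1
  · apply Finset.sum_congr _ (fun _ _ => rfl)
    ext S
    simp [Finset.insert_subset_iff, and_comm]
  · rw [Finset.mul_sum]
    refine Finset.sum_bij' (fun S _ => insert e S) (fun S _ => S.erase e) ?_ ?_ ?_ ?_ ?_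
    · intro S hS
      simp only [Finset.mem_filter, Finset.mem_univ, true_and] at hS ⊢
      exact Finset.insert_subset_insert _ hS.1
    · intro S hS
      simp only [Finset.mem_filter, Finset.mem_univ, true_and] at hS ⊢
      refine ⟨fun x hx => Finset.mem_erase.2 ⟨fun h => he (h ▸ hx), hS (by simp [hx])⟩, by simp⟩
    · intro S hS
      simp only [Finset.mem_filter, Finset.mem_univ, true_and] at hS
      exact Finset.erase_insert hS.2
    · intro S hS
      simp only [Finset.mem_filter, Finset.mem_univ, true_and] at hS
      exact Finset.insert_erase (hS (by simp))
    · intro S hS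
      simp only [Finset.mem_filter, Finset.mem_univ, true_and] at hS
      rw [Finset.card_insert_of_notMem hS.2, pow_succ]
      have : (H.filter (· ⊆ S)) = ((H.filter (e ∉ ·)).filter (· ⊆ insert e S)) := by
        ext T
        simp only [Finset.mem_filter]
        constructor
        · rintro ⟨h1, h2⟩
          exact ⟨⟨h1, fun h => hS.2 (h2 h)⟩, h2.trans (Finset.subset_insert _ _)⟩
        · rintro ⟨⟨h1, h2⟩, h3⟩
          exact ⟨h1, (Finset.subset_insert_iff_of_notMem h2).1 h3⟩
      rw [this]
      field_simp

lemma pinnedZ_insert {H : Finset (Finset E)} {T : Finset E} (hT : T ∉ H) (P : Finset E) :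
    pinnedZ lam zeta (insert T H) P =
      pinnedZ lam zeta H P - zeta * pinnedZ lam zeta H (P ∪ T) := by
  unfold pinnedZ
  have h1 : ∑ S : Finset E with P ∪ T ⊆ S, lam ^ S.card * (1 - zeta) ^ (H.filter (· ⊆ S)).card
      = ∑ S : Finset E with P ⊆ S, if T ⊆ S then
        lam ^ S.card * (1 - zeta) ^ (H.filter (· ⊆ S)).card else 0 := by
    rw [← Finset.sum_filter, Finset.filter_filter]
    simp only [Finset.union_subset_iff]
  rw [h1, Finset.mul_sum, ← Finset.sum_sub_distrib]
  refine Finset.sum_congr rfl fun S _ => ?_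
  rw [Finset.filter_insert]
  split_ifs with h
  · rw [Finset.card_insert_of_notMem (by simp [hT])]
    ring
  · ring

lemma occ_nonneg (hl : 0 < lam) (hz : zeta < 1) (H : Finset (Finset E)) (P : Finset E) (e : E) :
    0 ≤ occ lam zeta H P e :=
  div_nonneg (pinnedZ_pos hl hz H _).le (pinnedZ_pos hl hz H _).le

/-- The effect on the pinned partition function of adding the hyperedges through a pinned point. -/
lemma pinnedZ_insert_div (hl : 0 < lam) (hz : zeta < 1) {H : Finset (Finset E)} {T : Finset E}
    (hT : T ∉ H) (P : Finset E) :
    pinnedZ lam zeta (insert T H) P =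
      pinnedZ lam zeta H P * (1 - zeta * (pinnedZ lam zeta H (P ∪ T) / pinnedZ lam zeta H P)) := by
  rw [pinnedZ_insert hT]
  have := (pinnedZ_pos hl hz H P).ne'
  field_simp

/-- The ratio of the partition functions with and without the hyperedges through `e`. -/
def influence (lam zeta : ℝ) (H : Finset (Finset E)) (P : Finset E) (e : E) : ℝ :=
  pinnedZ lam zeta H (insert e P) / pinnedZ lam zeta (H.filter (e ∉ ·)) (insert e P)

lemma influence_pos (hl : 0 < lam) (hz : zeta < 1) (H : Finset (Finset E)) (P : Finset E) (e : E) :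
    0 < influence lam zeta H P e :=
  div_pos (pinnedZ_pos hl hz H _) (pinnedZ_pos hl hz _ _)

lemma occ_eq (hl : 0 < lam) (hz : zeta < 1) (H : Finset (Finset E)) {P : Finset E} {e : E}
    (he : e ∉ P) : occ lam zeta H P e =
      lam * influence lam zeta H P e / (1 + lam * influence lam zeta H P e) := by
  have h1 := pinnedZ_pos hl hz H (insert e P)
  have h2 := pinnedZ_pos hl hz (H.filter (e ∉ ·)) (insert e P)
  rw [occ, influence, pinnedZ_split hl.ne' H he]
  field_simp
  ring

lemma influence_le_one (hl : 0 < lam) (hz0 : 0 ≤ zeta) (hz : zeta < 1) (H : Finset (Finset E))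
    (P : Finset E) (e : E) : influence lam zeta H P e ≤ 1 := by
  rw [influence, div_le_one (pinnedZ_pos hl hz _ _)]
  refine Finset.sum_le_sum fun S _ => ?_
  refine mul_le_mul_of_nonneg_left ?_ (by positivity)
  refine pow_le_pow_of_le_one (by linarith) (by linarith) (Finset.card_le_card ?_)
  exact Finset.filter_subset_filter _ (Finset.filter_subset _ _)

lemma occ_le (hl : 0 < lam) (hz0 : 0 ≤ zeta) (hz : zeta < 1) (H : Finset (Finset E))
    {P : Finset E} {e : E} (he : e ∉ P) : occ lam zeta H P e ≤ lam := by
  have h1 := influence_pos hl hz H P e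
  have h2 := influence_le_one hl hz0 hz H P e
  have h3 : 0 < lam * influence lam zeta H P e := by positivity
  rw [occ_eq hl hz H he]
  refine (div_le_self h3.le (by linarith)).trans ?_
  nlinarith

lemma abs_occ_sub_le (hl : 0 < lam) (hz0 : 0 ≤ zeta) (hz : zeta < 1) (H : Finset (Finset E))
    {P : Finset E} {e : E} (he : e ∉ P) :
    |occ lam zeta H P e - lam * influence lam zeta H P e| ≤ lam ^ 2 := by
  have h1 := influence_pos hl hz H P e
  have h2 := influence_le_one hl hz0 hz H P e
  rw [occ_eq hl hz H he]
  set r := lam * influence lam zeta H P e with hr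
  have h3 : 0 < r := by positivity
  have h4 : r ≤ lam := by nlinarith
  have : r / (1 + r) - r = - (r ^ 2 / (1 + r)) := by field_simp; ring
  rw [this, abs_neg, abs_of_nonneg (by positivity)]
  refine (div_le_self (by positivity) (by linarith)).trans ?_
  gcongr

/-- Comparison of `influence` with a power, when adding the hyperedges through `e` one at a time
changes the partition function by factors close to `b`. -/
lemma abs_pinnedZ_union_div_sub_le (hl : 0 < lam) (hz0 : 0 ≤ zeta) (hz : zeta < 1)
    (H : Finset (Finset E)) (P : Finset E) {b : ℝ} (hb0 : 0 ≤ b) (hb1 : b ≤ 1)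
    (err : Finset E → ℝ) (A : Finset (Finset E)) (hA : Disjoint A H)
    (herr : ∀ T ∈ A, ∀ A' ⊆ A, T ∉ A' → |1 - zeta * (pinnedZ lam zeta (A' ∪ H) (P ∪ T) /
      pinnedZ lam zeta (A' ∪ H) P) - b| ≤ err T) :
    |pinnedZ lam zeta (A ∪ H) P / pinnedZ lam zeta H P - b ^ A.card| ≤ ∑ T ∈ A, err T := by
  induction A using Finset.induction_on with
  | empty => simp [(pinnedZ_pos hl hz H P).ne']
  | insert T A hT ih =>
    rw [Finset.disjoint_insert_left] at hA
    have ih := ih hA.2 fun T' hT' A' hA' =>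
      herr T' (Finset.mem_insert_of_mem hT') A' (hA'.trans (Finset.subset_insert _ _))
    have h := herr T (Finset.mem_insert_self _ _) A (Finset.subset_insert _ _) hT
    rw [Finset.insert_union, pinnedZ_insert_div hl hz (by simp [hT, hA.1]), Finset.sum_insert hT,
      Finset.card_insert_of_notMem hT, pow_succ]
    set r := pinnedZ lam zeta (A ∪ H) (P ∪ T) / pinnedZ lam zeta (A ∪ H) P
    have hr0 : 0 ≤ r := div_nonneg (pinnedZ_pos hl hz _ _).le (pinnedZ_pos hl hz _ _).le
    have hr1 : r ≤ 1 := (div_le_one (pinnedZ_pos hl hz _ _)).2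
      (pinnedZ_antitone hl hz _ Finset.subset_union_left)
    have e1 : pinnedZ lam zeta (A ∪ H) P * (1 - zeta * r) / pinnedZ lam zeta H P - b ^ A.card * b
        = (pinnedZ lam zeta (A ∪ H) P / pinnedZ lam zeta H P - b ^ A.card) * (1 - zeta * r)
          + b ^ A.card * (1 - zeta * r - b) := by ring
    have hzr : zeta * r ≤ 1 := by nlinarith
    have hzr0 : 0 ≤ zeta * r := by positivity
    have hbA : b ^ A.card ≤ 1 := pow_le_one₀ hb0 hb1
    rw [e1]
    refine (abs_add_le _ _).trans ?_
    rw [abs_mul, abs_mul, add_comm]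
    refine add_le_add ?_ ?_
    · rw [abs_of_nonneg (by positivity : 0 ≤ b ^ A.card)]
      exact (mul_le_of_le_one_left (abs_nonneg _) hbA).trans h
    · rw [abs_of_nonneg (by linarith : 0 ≤ 1 - zeta * r)]
      exact (mul_le_of_le_one_right (abs_nonneg _) (by linarith)).trans ih

end Pinned

/-- `𝓗` is a linear `3`-uniform hypergraph, regular of degree `d`. -/
structure IsLinearThreeGraph {E : Type*} [DecidableEq E] (𝓗 : Finset (Finset E)) (d : ℕ) :
    Prop where
  card_eq : ∀ T ∈ 𝓗, T.card = 3
  linear : ∀ T ∈ 𝓗, ∀ T' ∈ 𝓗, ∀ a b, a ≠ b → a ∈ T → b ∈ T → a ∈ T' → b ∈ T' → T = T'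
  degree : ∀ e, (𝓗.filter (e ∈ ·)).card = d

/-- The points completing a hyperedge together with two points of `P`. -/
def completions {E : Type*} [Fintype E] [DecidableEq E] (𝓗 : Finset (Finset E)) (P : Finset E) :
    Finset E :=
  Finset.univ.filter fun f => ∃ T ∈ 𝓗, f ∈ T ∧ T.erase f ⊆ P

/-- `H` contains all hyperedges of `𝓗` avoiding `P`, and the point `e ∉ P` does not complete a
hyperedge of `H` with two points of `P`. -/
structure Admissible {E : Type*} [DecidableEq E] (𝓗 H : Finset (Finset E))
    (P : Finset E) (e : E) : Prop where
  subset : H ⊆ 𝓗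
  mem_of_disjoint : ∀ T ∈ 𝓗, Disjoint T P → T ∈ H
  notMem : e ∉ P
  free : ∀ T ∈ H, e ∈ T → ¬ T.erase e ⊆ P

section Hyper

variable {E : Type*} [Fintype E] [DecidableEq E] {lam zeta : ℝ} {𝓗 H : Finset (Finset E)} {d : ℕ}
  {P : Finset E} {e f g : E} {T : Finset E} {A' : Finset (Finset E)}

lemma IsLinearThreeGraph.card_completions_le (h𝓗 : IsLinearThreeGraph 𝓗 d) (P : Finset E) :
    (completions 𝓗 P).card ≤ P.card * P.card := by
  rw [← Finset.card_product]
  refine Finset.card_le_card_of_forall_subsingleton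
    (fun f ab => ab.1 ≠ ab.2 ∧ f ≠ ab.1 ∧ f ≠ ab.2 ∧ ({f, ab.1, ab.2} : Finset E) ∈ 𝓗) ?_ ?_
  · intro f hf
    obtain ⟨T, hT, hfT, hTP⟩ := (Finset.mem_filter.1 hf).2
    have hc : (T.erase f).card = 2 := by rw [Finset.card_erase_of_mem hfT, h𝓗.card_eq T hT]
    obtain ⟨a, b, hab, hTe⟩ := Finset.card_eq_two.1 hc
    have ha : a ∈ T.erase f := by simp [hTe]
    have hb : b ∈ T.erase f := by simp [hTe]
    refine ⟨(a, b), Finset.mem_product.2 ⟨hTP ha, hTP hb⟩, hab, ?_, ?_, ?_⟩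
    · exact (Finset.ne_of_mem_erase ha).symm
    · exact (Finset.ne_of_mem_erase hb).symm
    · rw [← hTe, Finset.insert_erase hfT]
      exact hT
  · rintro ⟨a, b⟩ - f ⟨-, hab, hfa, hfb, hf⟩ f' ⟨-, -, hfa', hfb', hf'⟩
    have := h𝓗.linear _ hf _ hf' a b hab (by simp) (by simp) (by simp) (by simp)
    have hm : f ∈ ({f', a, b} : Finset E) := by rw [← this]; simp
    simp only [Finset.mem_insert, Finset.mem_singleton] at hm
    simp only at hfa hfb
    tauto

/-- The hyperedges through `e` meeting, away from `e`, the set `P` or its completions. -/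
def exceptional (𝓗 : Finset (Finset E)) (P : Finset E) (e : E) : Finset (Finset E) :=
  𝓗.filter fun T => e ∈ T ∧ ∃ f ∈ T, f ≠ e ∧ f ∈ P ∪ completions 𝓗 P

lemma IsLinearThreeGraph.card_exceptional_le (h𝓗 : IsLinearThreeGraph 𝓗 d) (P : Finset E) (e : E) :
    (exceptional 𝓗 P e).card ≤ P.card + P.card * P.card := by
  refine le_trans ?_ ((Finset.card_union_le P (completions 𝓗 P)).trans
    (Nat.add_le_add_left (h𝓗.card_completions_le P) _))
  refine Finset.card_le_card_of_forall_subsingleton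
    (fun T f => T ∈ 𝓗 ∧ e ∈ T ∧ f ∈ T ∧ f ≠ e) ?_ ?_
  · intro T hT
    obtain ⟨hT, heT, f, hf, hfe, hfP⟩ := Finset.mem_filter.1 hT
    exact ⟨f, hfP, hT, heT, hf, hfe⟩
  · rintro f - T ⟨-, hT, heT, hfT, hfe⟩ T' ⟨-, hT', heT', hfT', -⟩
    exact h𝓗.linear T hT T' hT' e f hfe.symm heT hfT heT' hfT'

lemma Admissible.insert_left (h𝓗 : IsLinearThreeGraph 𝓗 d) (h : Admissible 𝓗 H P e)
    (hA' : A' ⊆ H) (hT : T ∈ 𝓗) (hTA : T ∉ A') (heT : e ∈ T) (hf : f ∈ T) (hfe : f ≠ e)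
    (hfP : f ∉ P ∪ completions 𝓗 P) :
    Admissible 𝓗 (A' ∪ H.filter (e ∉ ·)) (insert e P) f where
  subset := Finset.union_subset (hA'.trans h.subset) ((Finset.filter_subset _ _).trans h.subset)
  mem_of_disjoint T' hT' hd := by
    rw [Finset.disjoint_insert_right] at hd
    exact Finset.mem_union_right _ (Finset.mem_filter.2 ⟨h.mem_of_disjoint T' hT' hd.2, hd.1⟩)
  notMem := by
    simp only [Finset.mem_union, not_or] at hfP
    simp [hfe, hfP.1]
  free T' hT' hfT' hs := by
    have hT'' : T' ∈ 𝓗 := by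
      rcases Finset.mem_union.1 hT' with h1 | h1
      exacts [h.subset (hA' h1), h.subset (Finset.mem_filter.1 h1).1]
    by_cases he : e ∈ T'
    · have := h𝓗.linear T hT T' hT'' e f hfe.symm heT hf he hfT'
      subst this
      simp [hTA, heT] at hT'
    · refine hfP (Finset.mem_union_right _ (Finset.mem_filter.2 ⟨Finset.mem_univ _, T', hT'', hfT',
        (Finset.subset_insert_iff_of_notMem fun h => he (Finset.mem_of_mem_erase h)).1 hs⟩))

lemma Admissible.insert_insert (h𝓗 : IsLinearThreeGraph 𝓗 d) (h : Admissible 𝓗 H P e)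
    (hA' : A' ⊆ H) (hT : T ∈ 𝓗) (hTA : T ∉ A') (heT : e ∈ T) (hf : f ∈ T)
    (hg : g ∈ T) (hge : g ≠ e) (hgf : g ≠ f) (hgP : g ∉ P ∪ completions 𝓗 P) :
    Admissible 𝓗 (A' ∪ H.filter (e ∉ ·)) (insert f (insert e P)) g where
  subset := Finset.union_subset (hA'.trans h.subset) ((Finset.filter_subset _ _).trans h.subset)
  mem_of_disjoint T' hT' hd := by
    rw [Finset.disjoint_insert_right, Finset.disjoint_insert_right] at hd
    exact Finset.mem_union_right _ (Finset.mem_filter.2 ⟨h.mem_of_disjoint T' hT' hd.2.2, hd.2.1⟩)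
  notMem := by
    simp only [Finset.mem_union, not_or] at hgP
    simp [hge, hgf, hgP.1]
  free T' hT' hgT' hs := by
    have hT'' : T' ∈ 𝓗 := by
      rcases Finset.mem_union.1 hT' with h1 | h1
      exacts [h.subset (hA' h1), h.subset (Finset.mem_filter.1 h1).1]
    have key : T ≠ T' := by
      rintro rfl
      simp [hTA, heT] at hT'
    have he : e ∉ T' := fun he => key (h𝓗.linear T hT T' hT'' e g hge.symm heT hg he hgT')
    have hf : f ∉ T' := fun hf' => key (h𝓗.linear T hT T' hT'' f g hgf.symm hf hg hf' hgT')
    refine hgP (Finset.mem_union_right _ (Finset.mem_filter.2 ⟨Finset.mem_univ _, T', hT'', hgT', ?_⟩))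
    rw [Finset.subset_insert_iff_of_notMem fun h => hf (Finset.mem_of_mem_erase h),
      Finset.subset_insert_iff_of_notMem fun h => he (Finset.mem_of_mem_erase h)] at hs
    exact hs

/-- For a hyperedge `T` through `e` in admissible position, the conditional probability of `T` is
at most `lam`. -/
lemma Admissible.pinnedZ_div_le (hl : 0 < lam) (hz0 : 0 ≤ zeta) (hz : zeta < 1)
    (h : Admissible 𝓗 H P e) (hT : T ∈ H) (heT : e ∈ T) (H' : Finset (Finset E)) :
    pinnedZ lam zeta H' (insert e P ∪ T) / pinnedZ lam zeta H' (insert e P) ≤ lam := by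
  obtain ⟨f, hf, hfP⟩ := Finset.not_subset.1 (h.free T hT heT)
  have hfe := Finset.ne_of_mem_erase hf
  have hfT := Finset.mem_of_mem_erase hf
  refine le_trans ?_ (occ_le hl hz0 hz H' (P := insert e P) (e := f) (by simp [hfe, hfP]))
  refine div_le_div_of_nonneg_right (pinnedZ_antitone hl hz H' ?_) (pinnedZ_pos hl hz _ _).le
  intro x hx
  rcases Finset.mem_insert.1 hx with rfl | hx
  · exact Finset.mem_union_right _ hfT
  · exact Finset.mem_union_left _ hx

lemma pinnedZ_div_eq_occ_mul_occ (hl : 0 < lam) (hz : zeta < 1) (H' : Finset (Finset E))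
    (hT : T = {e, f, g}) :
    pinnedZ lam zeta H' (insert e P ∪ T) / pinnedZ lam zeta H' (insert e P) =
      occ lam zeta H' (insert e P) f * occ lam zeta H' (insert f (insert e P)) g := by
  have : insert e P ∪ T = insert g (insert f (insert e P)) := by
    subst hT
    ext x
    simp only [Finset.mem_union, Finset.mem_insert, Finset.mem_singleton]
    tauto
  rw [this, occ, occ]
  have := (pinnedZ_pos hl hz H' (insert f (insert e P))).ne'
  field_simp

end Hyper

lemma abs_one_sub_sub_exp_neg_le {x : ℝ} (hx0 : 0 ≤ x) (hx1 : x ≤ 1) :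
    |1 - x - Real.exp (-x)| ≤ x ^ 2 := by
  have := Real.abs_exp_sub_one_sub_id_le (x := -x) (by rw [abs_neg, abs_of_nonneg hx0]; exact hx1)
  rw [abs_sub_comm]
  calc _ = |Real.exp (-x) - 1 - -x| := by congr 1; ring
    _ ≤ _ := by simpa using this

lemma abs_mul_sub_le {s c q x y δ : ℝ} (hs : 0 < s) (hq : 0 ≤ q) (hqc : q ≤ c)
    (hy0 : 0 ≤ y) (hyc : s * y ≤ c) (h1 : |s * x - q| ≤ δ) (h2 : |s * y - q| ≤ δ) :
    |x * y - q ^ 2 / s ^ 2| ≤ 2 * c * δ / s ^ 2 := by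
  have e : x * y - q ^ 2 / s ^ 2 = ((s * x - q) * (s * y) + q * (s * y - q)) / s ^ 2 := by
    field_simp; ring
  rw [e, abs_div, abs_of_pos (by positivity : 0 < s ^ 2)]
  gcongr
  refine (abs_add_le _ _).trans ?_
  rw [abs_mul, abs_mul q, abs_of_nonneg hq, abs_of_nonneg (by positivity : 0 ≤ s * y)]
  have hd : 0 ≤ δ := (abs_nonneg _).trans h1
  nlinarith [mul_le_mul h1 hyc (by positivity) hd, mul_le_mul hqc h2 (abs_nonneg _) (hq.trans hqc)]

section Step

variable {E : Type*} [Fintype E] [DecidableEq E] {zeta c q δ : ℝ} {𝓗 H : Finset (Finset E)} {d : ℕ}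
  {P : Finset E} {e : E}

/-- One step of the recursion: closeness of the occupation probabilities to `q / √d` for slightly
larger pinned sets improves to closeness with a contracted error. -/
lemma abs_occ_sub_le_of_forall (h𝓗 : IsLinearThreeGraph 𝓗 d) (hc : 0 < c) (hz0 : 0 ≤ zeta)
    (hz : zeta < 1) (hq0 : 0 ≤ q) (hq : q = c * Real.exp (-(zeta * q ^ 2)))
    (hd : 0 < d) (hdc : c ^ 2 ≤ d) {K : ℕ} (hK : P.card ≤ K) (h : Admissible 𝓗 H P e)
    (ih : ∀ H' P' f, P'.card ≤ K + 2 → Admissible 𝓗 H' P' f →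
      |√d * occ (c / √d) zeta H' P' f - q| ≤ δ) :
    |√d * occ (c / √d) zeta H P e - q| ≤
      2 * zeta * c ^ 2 * δ + (c ^ 2 + c * (c ^ 4 + (K + K * K) * (c + 2 * c ^ 2))) / √d := by
  have hd0 : (0 : ℝ) < d := by exact_mod_cast hd
  set s := √(d : ℝ) with hs
  have hs0 : 0 < s := Real.sqrt_pos.2 hd0
  have hs1 : 1 ≤ s := by
    rw [hs, Real.one_le_sqrt]; exact_mod_cast hd
  have hss : s ^ 2 = d := Real.sq_sqrt hd0.le
  set lam := c / s with hlam
  have hl : 0 < lam := by positivity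
  have hsl : s * lam = c := by rw [hlam]; field_simp
  have hδ : 0 ≤ δ := (abs_nonneg _).trans (ih H P e (by omega) h)
  have hqc : q ≤ c := by
    rw [hq]
    refine mul_le_of_le_one_right hc.le (Real.exp_le_one_iff.2 ?_)
    have : 0 ≤ zeta * q ^ 2 := by positivity
    linarith
  set x := zeta * q ^ 2 / s ^ 2 with hx
  have hx0 : 0 ≤ x := by positivity
  have hxc : x ≤ c ^ 2 / s ^ 2 := by
    rw [hx]
    gcongr
    calc zeta * q ^ 2 ≤ 1 * c ^ 2 := by gcongr
      _ = c ^ 2 := one_mul _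
  have hx1 : x ≤ 1 := hxc.trans ((div_le_one (by positivity)).2 (by rw [hss]; exact hdc))
  set b := Real.exp (-x) with hb
  have hb0 : 0 ≤ b := (Real.exp_pos _).le
  have hb1 : b ≤ 1 := Real.exp_le_one_iff.2 (by linarith)
  have hbx : 1 - b ≤ x := by linarith [Real.add_one_le_exp (-x)]
  have hbd : b ^ d = Real.exp (-(zeta * q ^ 2)) := by
    rw [hb, ← Real.exp_nat_mul, hx, hss]
    congr 1
    field_simp
  set X := exceptional 𝓗 P e with hX
  set A := H.filter (e ∈ ·) with hA
  set H0 := H.filter (e ∉ ·) with hH0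
  have hAH : A ∪ H0 = H := Finset.filter_union_filter_not_eq _ _
  have hAd : Disjoint A H0 := Finset.disjoint_filter_filter_not _ _ _
  set err : Finset E → ℝ := fun T =>
    (2 * c * zeta * δ / s ^ 2 + x ^ 2) + if T ∈ X then zeta * lam + x else 0 with herr
  have hmain := abs_pinnedZ_union_div_sub_le hl hz0 hz H0 (insert e P) hb0 hb1 err A hAd ?_
  swap
  · intro T hTA A' hA' hTA'
    obtain ⟨hTH, heT⟩ := Finset.mem_filter.1 hTA
    have hT𝓗 := h.subset hTH
    have hδ0 : 0 ≤ 2 * c * zeta * δ / s ^ 2 := by positivity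
    have hA'H : A' ⊆ H := hA'.trans (Finset.filter_subset _ _)
    by_cases hTX : T ∈ X
    · simp only [herr, if_pos hTX]
      have h1 := h.pinnedZ_div_le hl hz0 hz hTH heT (A' ∪ H0)
      set r := pinnedZ lam zeta (A' ∪ H0) (insert e P ∪ T) /
        pinnedZ lam zeta (A' ∪ H0) (insert e P)
      have hr0 : 0 ≤ r := div_nonneg (pinnedZ_pos hl hz _ _).le (pinnedZ_pos hl hz _ _).le
      have h3 : zeta * r ≤ zeta * lam := by gcongr
      have h4 : 0 ≤ zeta * r := by positivity
      rw [abs_le]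
      constructor <;> nlinarith [sq_nonneg x]
    · simp only [herr, if_neg hTX, add_zero]
      obtain ⟨f, g, hfg, hTe⟩ : ∃ f g, f ≠ g ∧ T.erase e = {f, g} :=
        Finset.card_eq_two.1 (by rw [Finset.card_erase_of_mem heT, h𝓗.card_eq T hT𝓗])
      have hf : f ∈ T.erase e := by simp [hTe]
      have hg : g ∈ T.erase e := by simp [hTe]
      have hfe := Finset.ne_of_mem_erase hf
      have hge := Finset.ne_of_mem_erase hg
      have hfT := Finset.mem_of_mem_erase hf
      have hgT := Finset.mem_of_mem_erase hg
      have hgood : ∀ f ∈ T, f ≠ e → f ∉ P ∪ completions 𝓗 P := fun f hf hfe hfP =>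
        hTX (Finset.mem_filter.2 ⟨hT𝓗, heT, f, hf, hfe, hfP⟩)
      have hT3 : T = {e, f, g} := by rw [← hTe, Finset.insert_erase heT]
      have af := h.insert_left h𝓗 hA'H hT𝓗 hTA' heT hfT hfe (hgood f hfT hfe)
      have ag := h.insert_insert h𝓗 hA'H hT𝓗 hTA' heT hfT hgT hge hfg.symm (hgood g hgT hge)
      rw [pinnedZ_div_eq_occ_mul_occ hl hz _ hT3]
      have hc1 := Finset.card_insert_le e P
      have hc2 := Finset.card_insert_le f (insert e P)
      have i1 := ih _ _ f (by omega) af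
      have i2 := ih _ _ g (by omega) ag
      have o1 := occ_nonneg hl hz (A' ∪ H0) (insert f (insert e P)) g
      have o2 : s * occ lam zeta (A' ∪ H0) (insert f (insert e P)) g ≤ c := by
        rw [← hsl]
        gcongr
        exact occ_le hl hz0 hz _ ag.notMem
      have := abs_mul_sub_le hs0 hq0 hqc o1 o2 i1 i2
      set r := occ lam zeta (A' ∪ H0) (insert e P) f *
        occ lam zeta (A' ∪ H0) (insert f (insert e P)) g
      have e1 : 1 - zeta * r - b = (1 - x - b) - zeta * (r - q ^ 2 / s ^ 2) := by
        rw [hx]; ring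
      rw [e1]
      refine (abs_sub _ _).trans ?_
      rw [abs_mul, abs_of_nonneg hz0, add_comm]
      refine add_le_add ?_ (abs_one_sub_sub_exp_neg_le hx0 hx1)
      calc _ ≤ zeta * (2 * c * δ / s ^ 2) := by gcongr
        _ = _ := by ring
  rw [hAH] at hmain
  have hinf : pinnedZ lam zeta H (insert e P) / pinnedZ lam zeta H0 (insert e P) =
    influence lam zeta H P e := rfl
  rw [hinf] at hmain
  set I := influence lam zeta H P e
  have hAsub : A ⊆ 𝓗.filter (e ∈ ·) := Finset.filter_subset_filter _ h.subset
  have hAd' : A.card ≤ d := (Finset.card_le_card hAsub).trans (h𝓗.degree e).le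
  have hXK : (X.card : ℝ) ≤ K + K * K := by
    have h1 : X.card ≤ K + K * K := (h𝓗.card_exceptional_le P e).trans (by gcongr)
    exact_mod_cast h1
  have hmiss : d ≤ A.card + X.card := by
    rw [← h𝓗.degree e, ← Finset.card_sdiff_add_card_eq_card hAsub, add_comm]
    refine Nat.add_le_add_left (Finset.card_le_card fun T hT => ?_) _
    obtain ⟨hT1, hT2⟩ := Finset.mem_sdiff.1 hT
    obtain ⟨hT, heT⟩ := Finset.mem_filter.1 hT1
    have : ¬ Disjoint T P := fun hd =>
      hT2 (Finset.mem_filter.2 ⟨h.mem_of_disjoint T hT hd, heT⟩)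
    obtain ⟨f, hf, hfP⟩ := Finset.not_disjoint_iff.1 this
    exact Finset.mem_filter.2 ⟨hT, heT, f, hf, fun hfe => h.notMem (hfe ▸ hfP),
      Finset.mem_union_left _ hfP⟩
  have hpow : |b ^ A.card - b ^ d| ≤ X.card * x := by
    obtain ⟨m, hm⟩ := Nat.exists_eq_add_of_le hAd'
    have hmX : (m : ℝ) ≤ X.card := by exact_mod_cast (by omega : m ≤ X.card)
    have h1 : 1 - m * x ≤ b ^ m := by
      have := one_add_mul_le_pow (a := b - 1) (by linarith) m
      rw [add_sub_cancel] at this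
      have h2 : (m : ℝ) * (1 - b) ≤ m * x := by gcongr
      linarith
    have h2 : b ^ A.card ≤ 1 := pow_le_one₀ hb0 hb1
    have h3 : b ^ m ≤ 1 := pow_le_one₀ hb0 hb1
    have h4 : 0 ≤ b ^ A.card := by positivity
    have e1 : b ^ A.card - b ^ d = b ^ A.card * (1 - b ^ m) := by rw [hm, pow_add]; ring
    rw [e1, abs_of_nonneg (mul_nonneg h4 (by linarith))]
    calc _ ≤ 1 * (1 - b ^ m) := by gcongr
      _ ≤ m * x := by linarith
      _ ≤ _ := by gcongr
  have hsum : ∑ T ∈ A, err T ≤ 2 * c * zeta * δ + d * x ^ 2 + X.card * (zeta * lam + x) := by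
    rw [herr, Finset.sum_add_distrib, Finset.sum_const, nsmul_eq_mul, ← Finset.sum_filter,
      Finset.sum_const, nsmul_eq_mul]
    have h1 : (A.card : ℝ) ≤ d := by exact_mod_cast hAd'
    have h2 : ((A.filter (· ∈ X)).card : ℝ) ≤ X.card := by
      exact_mod_cast Finset.card_le_card fun T hT => (Finset.mem_filter.1 hT).2
    have e1 : 2 * c * zeta * δ + d * x ^ 2 = d * (2 * c * zeta * δ / s ^ 2 + x ^ 2) := by
      rw [hss]; field_simp
    rw [e1]
    gcongr
  have hs12 : 1 / s ^ 2 ≤ 1 / s := by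
    apply one_div_le_one_div_of_le hs0
    nlinarith
  have hx_s : x ≤ c ^ 2 / s := by
    refine hxc.trans ?_
    rw [div_eq_mul_one_div, div_eq_mul_one_div (c ^ 2) s]
    gcongr
  have hdx : d * x ^ 2 ≤ c ^ 4 / s := by
    rw [← hss]
    calc s ^ 2 * x ^ 2 ≤ s ^ 2 * (c ^ 2 / s ^ 2) ^ 2 := by gcongr
      _ = c ^ 4 * (1 / s ^ 2) := by field_simp
      _ ≤ c ^ 4 * (1 / s) := by gcongr
      _ = _ := by ring
  have hzl : zeta * lam ≤ c / s := mul_le_of_le_one_left hl.le hz.le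
  have hIe : |I - Real.exp (-(zeta * q ^ 2))| ≤
      2 * c * zeta * δ + (c ^ 4 + (K + K * K) * (c + 2 * c ^ 2)) / s := by
    rw [← hbd]
    have h1 : (X.card : ℝ) * (zeta * lam + x + x) ≤
        (K + K * K) * (c / s + c ^ 2 / s + c ^ 2 / s) := by gcongr
    have h2 : (c ^ 4 + (K + K * K) * (c + 2 * c ^ 2)) / s =
      c ^ 4 / s + (K + K * K) * (c / s + c ^ 2 / s + c ^ 2 / s) := by ring
    have h3 := abs_sub_le I (b ^ A.card) (b ^ d)
    rw [h2]
    linarith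
  have hocc := abs_occ_sub_le hl hz0 hz H h.notMem
  have e1 : s * occ lam zeta H P e - q =
      s * (occ lam zeta H P e - lam * I) + c * (I - Real.exp (-(zeta * q ^ 2))) := by
    have : q - c * Real.exp (-(zeta * q ^ 2)) = 0 := by linarith
    have h2 : s * lam * I = c * I := by rw [hsl]
    linear_combination -this + h2
  rw [e1]
  refine (abs_add_le _ _).trans ?_
  rw [abs_mul, abs_mul, abs_of_pos hs0, abs_of_pos hc]
  calc _ ≤ s * lam ^ 2 + c * (2 * c * zeta * δ +
        (c ^ 4 + (K + K * K) * (c + 2 * c ^ 2)) / s) := by gcongr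
    _ = _ := by rw [hlam]; field_simp; ring

/-- Occupation probabilities in linear regular hypergraphs of large degree are close to `q / √d`. -/
lemma exists_forall_abs_occ_sub_le (hc : 0 < c) (hz0 : 0 ≤ zeta) (hz : zeta < 1) (hq0 : 0 ≤ q)
    (hq : q = c * Real.exp (-(zeta * q ^ 2))) (k K : ℕ) {ε : ℝ} (hε : 0 < ε) :
    ∃ D : ℕ, ∀ (E : Type) [Fintype E] [DecidableEq E] (𝓗 : Finset (Finset E)) (d : ℕ), D ≤ d →
      IsLinearThreeGraph 𝓗 d → ∀ (H : Finset (Finset E)) (P : Finset E) (e : E), P.card ≤ K →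
      Admissible 𝓗 H P e →
      |√d * occ (c / √d) zeta H P e - q| ≤ (2 * zeta * c ^ 2) ^ k * c + ε := by
  induction k generalizing K ε with
  | zero =>
    refine ⟨1, fun E _ _ 𝓗 d hd h𝓗 H P e hP h => ?_⟩
    have hs0 : 0 < √(d : ℝ) := Real.sqrt_pos.2 (by exact_mod_cast hd)
    have hl : 0 < c / √d := by positivity
    have hqc : q ≤ c := by
      rw [hq]
      refine mul_le_of_le_one_right hc.le (Real.exp_le_one_iff.2 ?_)
      have : 0 ≤ zeta * q ^ 2 := by positivity
      linarith
    have h1 := occ_nonneg hl hz H P e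
    have h2 : √d * occ (c / √d) zeta H P e ≤ c := by
      calc _ ≤ √d * (c / √d) := by gcongr; exact occ_le hl hz0 hz H h.notMem
        _ = c := by field_simp
    have h3 : 0 ≤ √d * occ (c / √d) zeta H P e := by positivity
    rw [pow_zero, one_mul, abs_le]
    constructor <;> linarith
  | succ k ih =>
    set ρ := 2 * zeta * c ^ 2 with hρ
    have hρ0 : 0 ≤ ρ := by positivity
    obtain ⟨D, hD⟩ := ih (K + 2) (ε := ε / (2 * (ρ + 1))) (by positivity)
    set C := c ^ 2 + c * (c ^ 4 + (K + K * K) * (c + 2 * c ^ 2)) with hC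
    have hC0 : 0 < C := by positivity
    obtain ⟨D', hD'⟩ := exists_nat_ge (max (c ^ 2) ((2 * C / ε) ^ 2))
    refine ⟨max D (D' + 1), fun E _ _ 𝓗 d hd h𝓗 H P e hP h => ?_⟩
    have hdD : D ≤ d := (le_max_left _ _).trans hd
    have hdD' : (D' : ℝ) ≤ d := by exact_mod_cast (by omega : D' ≤ d)
    have hd0 : 0 < d := by omega
    have hs0 : 0 < √(d : ℝ) := Real.sqrt_pos.2 (by exact_mod_cast hd0)
    have := abs_occ_sub_le_of_forall h𝓗 hc hz0 hz hq0 hq hd0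
      (((le_max_left _ _).trans hD').trans hdD') hP h
      (fun H' P' f hP' h' => hD E 𝓗 d hdD h𝓗 H' P' f hP' h')
    refine this.trans ?_
    have h1 : C / √d ≤ ε / 2 := by
      have : 2 * C / ε ≤ √d :=
        Real.le_sqrt_of_sq_le (((le_max_right _ _).trans hD').trans hdD')
      rw [div_le_iff₀ hε] at this
      rw [div_le_iff₀ hs0]
      linarith
    have h2 : ρ * (ε / (2 * (ρ + 1))) ≤ ε / 2 := by
      rw [mul_div_assoc', div_le_div_iff₀ (by positivity) (by norm_num)]
      nlinarith
    rw [← hρ, ← hC] at this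
    have h3 : ρ ^ (k + 1) * c = ρ * (ρ ^ k * c) := by ring
    linarith

/-- In the contractive regime occupation probabilities are asymptotically `q / √d`. -/
lemma exists_forall_abs_occ_empty_sub_le (hc : 0 < c) (hz0 : 0 ≤ zeta) (hz : zeta < 1)
    (hq0 : 0 ≤ q) (hq : q = c * Real.exp (-(zeta * q ^ 2))) (hzc : 2 * zeta * c ^ 2 < 1) {ε : ℝ}
    (hε : 0 < ε) :
    ∃ D : ℕ, ∀ (E : Type) [Fintype E] [DecidableEq E] (𝓗 : Finset (Finset E)) (d : ℕ), D ≤ d →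
      IsLinearThreeGraph 𝓗 d → ∀ e : E, |√d * occ (c / √d) zeta 𝓗 ∅ e - q| ≤ ε := by
  obtain ⟨k, hk⟩ := exists_pow_lt_of_lt_one (show 0 < ε / (2 * c) by positivity) hzc
  obtain ⟨D, hD⟩ := exists_forall_abs_occ_sub_le hc hz0 hz hq0 hq k 0 (half_pos hε)
  refine ⟨D, fun E _ _ 𝓗 d hd h𝓗 e => (hD E 𝓗 d hd h𝓗 𝓗 ∅ e (by simp) ?_).trans ?_⟩
  · refine ⟨subset_rfl, fun T hT _ => hT, by simp, fun T hT he hs => ?_⟩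
    have h1 := Finset.card_erase_of_mem he
    rw [h𝓗.card_eq T hT, Finset.subset_empty.1 hs] at h1
    simp at h1
  · have : (2 * zeta * c ^ 2) ^ k * c ≤ ε / (2 * c) * c := by gcongr
    have h2 : ε / (2 * c) * c = ε / 2 := by field_simp
    linarith

end Step

/-- The derivative of `pinnedZ lam zeta H ∅` with respect to `lam`. -/
def pinnedZDeriv {E : Type*} [Fintype E] [DecidableEq E] (lam zeta : ℝ)
    (H : Finset (Finset E)) : ℝ :=
  ∑ S : Finset E, S.card * lam ^ (S.card - 1) * (1 - zeta) ^ (H.filter (· ⊆ S)).card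

section Derivative

variable {E : Type*} [Fintype E] [DecidableEq E] {lam zeta : ℝ} {H : Finset (Finset E)}

lemma pinnedZ_empty (lam zeta : ℝ) (H : Finset (Finset E)) : pinnedZ lam zeta H ∅ =
    ∑ S : Finset E, lam ^ S.card * (1 - zeta) ^ (H.filter (· ⊆ S)).card := by
  simp [pinnedZ]

lemma hasDerivAt_pinnedZ (lam zeta : ℝ) (H : Finset (Finset E)) :
    HasDerivAt (fun l => pinnedZ l zeta H ∅) (pinnedZDeriv lam zeta H) lam := by
  simp only [pinnedZ_empty, pinnedZDeriv]
  exact HasDerivAt.fun_sum fun S _ => (hasDerivAt_pow _ _).mul_const _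

lemma continuous_pinnedZDeriv (zeta : ℝ) (H : Finset (Finset E)) :
    Continuous fun l => pinnedZDeriv l zeta H := by
  unfold pinnedZDeriv
  fun_prop

lemma mul_pinnedZDeriv (lam zeta : ℝ) (H : Finset (Finset E)) :
    lam * pinnedZDeriv lam zeta H = ∑ e, pinnedZ lam zeta H {e} := by
  simp only [pinnedZDeriv, pinnedZ, Finset.mul_sum, Finset.singleton_subset_iff, Finset.sum_filter]
  rw [Finset.sum_comm]
  refine Finset.sum_congr rfl fun S _ => ?_
  rw [← Finset.sum_filter, Finset.sum_const, nsmul_eq_mul, Finset.filter_univ_mem]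
  rcases Nat.eq_zero_or_pos S.card with h | h
  · simp [h]
  · obtain ⟨m, hm⟩ := Nat.exists_eq_add_of_le' h
    simp only [hm, Nat.add_sub_cancel]
    ring

lemma pinnedZDeriv_div_eq (hl : 0 < lam) :
    pinnedZDeriv lam zeta H / pinnedZ lam zeta H ∅ = (∑ e, occ lam zeta H ∅ e) / lam := by
  have h := mul_pinnedZDeriv lam zeta H
  simp only [occ, ← Finset.sum_div, LawfulSingleton.insert_empty_eq]
  rw [← h]
  field_simp

lemma pinnedZ_zero (hH : ∅ ∉ H) : pinnedZ 0 zeta H ∅ = 1 := by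
  rw [pinnedZ_empty, Finset.sum_eq_single ∅]
  · have : H.filter (· ⊆ ∅) = ∅ := by
      rw [Finset.filter_eq_empty_iff]
      intro T hT hT'
      rw [Finset.subset_empty.1 hT'] at hT
      exact hH hT
    rw [this]
    simp
  · intro S _ hS
    simp [Finset.card_ne_zero.2 (Finset.nonempty_of_ne_empty hS)]
  · simp

lemma pinnedZ_empty_pos (hl : 0 ≤ lam) (hz : zeta < 1) (hH : ∅ ∉ H) :
    0 < pinnedZ lam zeta H ∅ := by
  rcases hl.eq_or_lt with rfl | hl
  · rw [pinnedZ_zero hH]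
    exact one_pos
  · exact pinnedZ_pos hl hz H ∅

end Derivative

lemma IsLinearThreeGraph.empty_notMem {E : Type*} [DecidableEq E] {𝓗 : Finset (Finset E)} {d : ℕ}
    (h : IsLinearThreeGraph 𝓗 d) : ∅ ∉ 𝓗 := fun h0 => by
  simpa using h.card_eq _ h0

/-- The logarithmic derivative of the partition function, per point. -/
def meanOcc {E : Type*} [Fintype E] [DecidableEq E] (zeta : ℝ) (H : Finset (Finset E)) (d : ℕ)
    (s : ℝ) : ℝ :=
  pinnedZDeriv (s / √d) zeta H / pinnedZ (s / √d) zeta H ∅ / Fintype.card E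

section MeanOcc

variable {E : Type*} [Fintype E] [DecidableEq E] {zeta : ℝ} {H : Finset (Finset E)} {d : ℕ}

lemma continuousOn_meanOcc (hz : zeta < 1) (hH : ∅ ∉ H) :
    ContinuousOn (meanOcc zeta H d) (Set.Ici 0) := by
  unfold meanOcc
  refine ContinuousOn.div_const (ContinuousOn.div ?_ ?_ ?_) _
  · exact ((continuous_pinnedZDeriv zeta H).comp (continuous_id.div_const _)).continuousOn
  · have : Continuous fun l => pinnedZ l zeta H ∅ :=
      continuous_iff_continuousAt.2 fun l => (hasDerivAt_pinnedZ l zeta H).continuousAt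
    exact (this.comp (continuous_id.div_const _)).continuousOn
  · intro s hs
    have : (0 : ℝ) ≤ s := hs
    exact (pinnedZ_empty_pos (by positivity) hz hH).ne'

lemma meanOcc_eq (hd : 0 < d) {s : ℝ} (hs : 0 < s) :
    meanOcc zeta H d s = (∑ e, √d * occ (s / √d) zeta H ∅ e) / Fintype.card E / s := by
  have hs0 : 0 < √(d : ℝ) := Real.sqrt_pos.2 (by exact_mod_cast hd)
  rw [meanOcc, pinnedZDeriv_div_eq (by positivity), ← Finset.mul_sum]
  field_simp

lemma abs_meanOcc_sub_le [Nonempty E] (hd : 0 < d) {s q ε : ℝ} (hs : 0 < s)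
    (h : ∀ e, |√d * occ (s / √d) zeta H ∅ e - q| ≤ ε) : |meanOcc zeta H d s - q / s| ≤ ε / s := by
  have hE : (0 : ℝ) < Fintype.card E := by exact_mod_cast Fintype.card_pos
  have e1 : meanOcc zeta H d s - q / s =
      (∑ e, (√d * occ (s / √d) zeta H ∅ e - q)) / Fintype.card E / s := by
    rw [meanOcc_eq hd hs, Finset.sum_sub_distrib, Finset.sum_const, nsmul_eq_mul, Finset.card_univ]
    field_simp
  rw [e1, abs_div, abs_div, abs_of_pos hs, abs_of_pos hE]
  gcongr
  rw [div_le_iff₀ hE]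
  refine (Finset.abs_sum_le_sum_abs _ _).trans ((Finset.sum_le_sum fun e _ => h e).trans ?_)
  rw [Finset.sum_const, nsmul_eq_mul, Finset.card_univ, mul_comm]

lemma abs_meanOcc_le (hd : 0 < d) (hz0 : 0 ≤ zeta) (hz : zeta < 1) {s : ℝ} (hs : 0 < s) :
    |meanOcc zeta H d s| ≤ 1 := by
  have hs0 : 0 < √(d : ℝ) := Real.sqrt_pos.2 (by exact_mod_cast hd)
  rcases isEmpty_or_nonempty E with hE | hE
  · simp [meanOcc]
  have := abs_meanOcc_sub_le (zeta := zeta) (H := H) hd hs (q := 0) (ε := s) fun e => ?_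
  · simpa [div_self hs.ne'] using this
  · have hl : 0 < s / √d := by positivity
    have h1 := occ_nonneg hl hz H ∅ e
    rw [sub_zero, abs_of_nonneg (by positivity)]
    calc _ ≤ √d * (s / √d) := by gcongr; exact occ_le hl hz0 hz H (by simp)
      _ = s := by field_simp

lemma integral_meanOcc (hd : 0 < d) (hz : zeta < 1) (hH : ∅ ∉ H) {s : ℝ} (hs : 0 ≤ s) :
    ∫ u in (0 : ℝ)..s, meanOcc zeta H d u =
      Real.log (pinnedZ (s / √d) zeta H ∅) / (Fintype.card E / √d) := by
  have hs0 : 0 < √(d : ℝ) := Real.sqrt_pos.2 (by exact_mod_cast hd)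
  rcases isEmpty_or_nonempty E with hE | hE
  · simp [meanOcc]
  have hE : (0 : ℝ) < Fintype.card E := by exact_mod_cast Fintype.card_pos
  have := intervalIntegral.integral_eq_sub_of_hasDerivAt
    (f := fun u => Real.log (pinnedZ (u / √d) zeta H ∅) / (Fintype.card E / √d))
    (f' := meanOcc zeta H d) (a := 0) (b := s) ?_ ?_
  · rw [this]
    simp [pinnedZ_zero hH]
  · intro u hu
    rw [Set.uIcc_of_le hs] at hu
    have hu0 := hu.1
    have h1 := (hasDerivAt_pinnedZ (u / √d) zeta H).comp u ((hasDerivAt_id u).div_const √d)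
    have h2 := (h1.log (pinnedZ_empty_pos (by positivity) hz hH).ne').div_const
      (Fintype.card E / √d)
    refine h2.congr_deriv ?_
    simp only [meanOcc, Function.comp_apply, id]
    field_simp
  · refine ContinuousOn.intervalIntegrable ((continuousOn_meanOcc hz hH).mono ?_)
    rw [Set.uIcc_of_le hs]
    exact fun x hx => hx.1

end MeanOcc

/-- Free energy asymptotics in the contractive regime. -/
lemma tendsto_log_pinnedZ_div {E : ℕ → Type} [∀ n, Fintype (E n)] [∀ n, DecidableEq (E n)]
    {𝓗 : ∀ n, Finset (Finset (E n))} {d : ℕ → ℕ} (hd : Tendsto d atTop atTop)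
    (hE : ∀ᶠ n in atTop, Nonempty (E n)) (h𝓗 : ∀ᶠ n in atTop, IsLinearThreeGraph (𝓗 n) (d n))
    {zeta c : ℝ} (hz0 : 0 ≤ zeta) (hz : zeta < 1) (hc : 0 < c) (hzc : 2 * zeta * c ^ 2 < 1)
    {Q F : ℝ → ℝ} (hQ0 : ∀ s, 0 < s → 0 ≤ Q s)
    (hQ : ∀ s, 0 < s → Q s = s * Real.exp (-(zeta * Q s ^ 2)))
    (hF : ContinuousOn F (Set.Icc 0 c)) (hF0 : F 0 = 0)
    (hF' : ∀ s ∈ Set.Ioo 0 c, HasDerivAt F (Q s / s) s)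
    (hQi : IntervalIntegrable (fun s => Q s / s) MeasureTheory.volume 0 c)
    {C : ℕ → ℝ} (hC : Tendsto C atTop (nhds c)) :
    Tendsto (fun n => Real.log (pinnedZ (C n / √(d n)) zeta (𝓗 n) ∅) /
      (Fintype.card (E n) / √(d n))) atTop (nhds (F c)) := by
  have hd0 : ∀ᶠ n in atTop, 0 < d n := hd.eventually_gt_atTop 0
  have hint : ∫ s in (0 : ℝ)..c, Q s / s = F c := by
    rw [intervalIntegral.integral_eq_sub_of_hasDerivAt_of_le hc.le hF hF' hQi, hF0, sub_zero]
  have h1 : Tendsto (fun n => ∫ s in (0 : ℝ)..c, meanOcc zeta (𝓗 n) (d n) s) atTop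
      (nhds (F c)) := by
    rw [← hint]
    refine intervalIntegral.tendsto_integral_filter_of_dominated_convergence (fun _ => 1) ?_ ?_
      intervalIntegrable_const ?_
    · filter_upwards [h𝓗] with n hn
      refine ContinuousOn.aestronglyMeasurable ?_ measurableSet_uIoc
      refine (continuousOn_meanOcc hz hn.empty_notMem).mono ?_
      rw [Set.uIoc_of_le hc.le]
      exact fun x hx => hx.1.le
    · filter_upwards [hd0] with n hn
      refine Eventually.of_forall fun s hs => ?_
      rw [Set.uIoc_of_le hc.le] at hs
      exact abs_meanOcc_le hn hz0 hz hs.1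
    · refine Eventually.of_forall fun s hs => ?_
      rw [Set.uIoc_of_le hc.le] at hs
      have hs0 := hs.1
      rw [Metric.tendsto_nhds]
      intro ε hε
      have hzs : 2 * zeta * s ^ 2 < 1 := by
        refine lt_of_le_of_lt ?_ hzc
        gcongr
        exact hs.2
      obtain ⟨D, hD⟩ := exists_forall_abs_occ_empty_sub_le hs0 hz0 hz (hQ0 s hs0) (hQ s hs0) hzs
        (show 0 < ε / 2 * s by positivity)
      filter_upwards [hd0, hE, h𝓗, hd.eventually_ge_atTop D] with n h1 h2 h3 h4
      rw [Real.dist_eq]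
      refine (abs_meanOcc_sub_le h1 hs0 (hD (E n) (𝓗 n) (d n) h4 h3)).trans_lt ?_
      rw [mul_div_cancel_right₀ _ hs0.ne']
      linarith
  have h2 : Tendsto (fun n => ∫ s in c..C n, meanOcc zeta (𝓗 n) (d n) s) atTop (nhds 0) := by
    have h3 : Tendsto (fun n => |C n - c|) atTop (nhds 0) := by
      have := (hC.sub_const c).abs
      simpa using this
    refine squeeze_zero_norm' ?_ h3
    filter_upwards [hd0, hC.eventually (lt_mem_nhds hc)] with n hn hCn
    have := intervalIntegral.norm_integral_le_of_norm_le_const (a := c) (b := C n) (C := 1)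
      (f := meanOcc zeta (𝓗 n) (d n)) fun s hs => ?_
    · simpa using this
    · refine abs_meanOcc_le hn hz0 hz ?_
      rcases Set.mem_uIoc.1 hs with h | h
      exacts [hc.trans h.1, hCn.trans h.1]
  have h3 := h1.add h2
  rw [add_zero] at h3
  refine h3.congr' ?_
  filter_upwards [hd0, hC.eventually (lt_mem_nhds hc), h𝓗] with n hn hCn h𝓗n
  have hcont := continuousOn_meanOcc (d := d n) hz h𝓗n.empty_notMem
  rw [← integral_meanOcc hn hz h𝓗n.empty_notMem hCn.le]
  refine intervalIntegral.integral_add_adjacent_intervals ?_ ?_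
  · refine ContinuousOn.intervalIntegrable (hcont.mono ?_)
    rw [Set.uIcc_of_le hc.le]
    exact fun x hx => hx.1
  · refine ContinuousOn.intervalIntegrable (hcont.mono ?_)
    intro x hx
    rcases Set.mem_uIcc.1 hx with h | h
    exacts [hc.le.trans h.1, hCn.le.trans h.1]

/-- The Laplace transform at `θ` of the weighted sum over `Ω`. -/
def laplaceSum {Ω : Type*} [Fintype Ω] (w X : Ω → ℝ) (θ : ℝ) : ℝ := ∑ ω, w ω * Real.exp (-θ * X ω)

section Laplace

variable {Ω : Type*} [Fintype Ω] {w X : Ω → ℝ}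

lemma sum_filter_le_laplaceSum (hw : ∀ ω, 0 ≤ w ω) (θ s y : ℝ) :
    ∑ ω with s * y ≤ s * X ω, w ω * Real.exp (-θ * X ω) ≤
      Real.exp (-(s * y)) * laplaceSum w X (θ - s) := by
  rw [laplaceSum, Finset.mul_sum]
  refine (Finset.sum_le_sum (g := fun ω => Real.exp (-(s * y)) * (w ω * Real.exp (-(θ - s) * X ω)))
    fun ω hω => ?_).trans
    (Finset.sum_le_sum_of_subset_of_nonneg (Finset.filter_subset _ _) fun ω _ _ => ?_)
  · have h := (Finset.mem_filter.1 hω).2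
    rw [mul_left_comm, ← Real.exp_add]
    refine mul_le_mul_of_nonneg_left (Real.exp_le_exp.2 ?_) (hw ω)
    linarith
  · have := hw ω
    positivity

lemma sum_filter_le_exp_mul_laplaceSum (hw : ∀ ω, 0 ≤ w ω) {θ : ℝ} (hθ : 0 ≤ θ) (x : ℝ) :
    ∑ ω with X ω ≤ x, w ω ≤ Real.exp (θ * x) * laplaceSum w X θ := by
  rw [laplaceSum, Finset.mul_sum]
  refine (Finset.sum_le_sum (g := fun ω => Real.exp (θ * x) * (w ω * Real.exp (-θ * X ω)))
    fun ω hω => ?_).trans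
    (Finset.sum_le_sum_of_subset_of_nonneg (Finset.filter_subset _ _) fun ω _ _ => ?_)
  · have h := (Finset.mem_filter.1 hω).2
    rw [mul_left_comm, ← Real.exp_add]
    refine le_mul_of_one_le_right (hw ω) (Real.one_le_exp ?_)
    nlinarith
  · have := hw ω
    positivity

/-- If the tilted measure charges mostly the window `(y, z)`, the lower tail at `x ≥ z` is bounded
below. -/
lemma laplaceSum_le_of_tails (hw : ∀ ω, 0 ≤ w ω) {θ s t x y z : ℝ} (hθ : 0 ≤ θ) (hs : 0 < s)
    (ht : 0 < t) (hzx : z ≤ x)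
    (h1 : Real.exp (-(s * z)) * laplaceSum w X (θ - s) ≤ laplaceSum w X θ / 4)
    (h2 : Real.exp (-(-t * y)) * laplaceSum w X (θ - -t) ≤ laplaceSum w X θ / 4) :
    Real.exp (θ * y) * (laplaceSum w X θ / 2) ≤ ∑ ω with X ω ≤ x, w ω := by
  have h1 := (sum_filter_le_laplaceSum hw θ s z).trans h1
  have h2 := (sum_filter_le_laplaceSum hw θ (-t) y).trans h2
  have key : laplaceSum w X θ ≤ ∑ ω with s * z ≤ s * X ω, w ω * Real.exp (-θ * X ω) +
      ∑ ω with -t * y ≤ -t * X ω, w ω * Real.exp (-θ * X ω) +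
      Real.exp (-(θ * y)) * ∑ ω with X ω ≤ x, w ω := by
    rw [laplaceSum, Finset.mul_sum, Finset.sum_filter, Finset.sum_filter, Finset.sum_filter,
      ← Finset.sum_add_distrib, ← Finset.sum_add_distrib]
    refine Finset.sum_le_sum fun ω _ => ?_
    have hω := hw ω
    have p1 : 0 ≤ w ω * Real.exp (-θ * X ω) := by positivity
    have p2 : 0 ≤ Real.exp (-(θ * y)) * w ω := by positivity
    by_cases c1 : s * z ≤ s * X ω
    · rw [if_pos c1]
      split_ifs <;> linarith
    · by_cases c2 : -t * y ≤ -t * X ω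
      · rw [if_pos c2]
        split_ifs <;> linarith
      · have d1 : X ω < z := lt_of_mul_lt_mul_left (not_le.1 c1) hs.le
        have d2 : y < X ω := by nlinarith
        rw [if_neg c1, if_neg c2, if_pos (d1.le.trans hzx), zero_add, zero_add, mul_comm]
        gcongr
        nlinarith
  have e1 : Real.exp (θ * y) * Real.exp (-(θ * y)) = 1 := by rw [← Real.exp_add]; simp
  have h3 : laplaceSum w X θ / 2 ≤ Real.exp (-(θ * y)) * ∑ ω with X ω ≤ x, w ω := by linarith
  calc _ ≤ Real.exp (θ * y) * (Real.exp (-(θ * y)) * ∑ ω with X ω ≤ x, w ω) := by gcongr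
    _ = _ := by rw [← mul_assoc, e1, one_mul]

end Laplace

lemma eventually_exp_mul_le {a f g : ℕ → ℝ} {s z l l' : ℝ} (ha : Tendsto a atTop atTop)
    (hf0 : ∀ᶠ n in atTop, 0 < f n) (hg0 : ∀ᶠ n in atTop, 0 < g n)
    (hf : Tendsto (fun n => Real.log (f n) / a n) atTop (nhds l))
    (hg : Tendsto (fun n => Real.log (g n) / a n) atTop (nhds l')) (h : l - l' < s * z) :
    ∀ᶠ n in atTop, Real.exp (-(s * (z * a n))) * f n ≤ g n / 4 := by
  have h1 := (hf.sub hg).eventually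
    (gt_mem_nhds (show l - l' < (l - l' + s * z) / 2 by linarith))
  have h2 := ha.eventually_ge_atTop (Real.log 4 / ((s * z - (l - l')) / 2))
  filter_upwards [hf0, hg0, h1, h2, ha.eventually_gt_atTop 0] with n hf hg h1 h2 h3
  rw [div_le_iff₀ (by linarith)] at h2
  rw [← sub_div, div_lt_iff₀ h3] at h1
  rw [← Real.log_le_log_iff (by positivity) (by positivity),
    Real.log_mul (Real.exp_pos _).ne' hf.ne', Real.log_exp, Real.log_div hg.ne' (by norm_num)]
  nlinarith

lemma exists_sub_lt_mul_of_hasDerivAt {L : ℝ → ℝ} {m θ z r : ℝ} (hL : HasDerivAt L (-m) θ)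
    (hr : 0 < r) (hz : m < z) : ∃ s, 0 < s ∧ s < r ∧ L (θ - s) - L θ < s * z := by
  have h := hL.tendsto_slope_zero_left.eventually (lt_mem_nhds (show -z < -m by linarith))
  have h2 : ∀ᶠ t in nhdsWithin (0 : ℝ) (Set.Iio 0), -r < t ∧ t < 0 := by
    filter_upwards [mem_nhdsWithin_of_mem_nhds (lt_mem_nhds (show -r < (0 : ℝ) by linarith)),
      self_mem_nhdsWithin] with t h1 h2
    exact ⟨h1, h2⟩
  obtain ⟨t, h1, h2, h3⟩ := (h.and h2).exists
  refine ⟨-t, by linarith, by linarith, ?_⟩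
  rw [sub_neg_eq_add]
  rw [smul_eq_mul, ← div_eq_inv_mul, lt_div_iff_of_neg h3] at h1
  linarith

/-- A Gärtner–Ellis type theorem for lower tails. -/
lemma tendsto_log_sum_filter_le {Ω : ℕ → Type} [∀ n, Fintype (Ω n)] {w X : ∀ n, Ω n → ℝ}
    (hw : ∀ n ω, 0 ≤ w n ω) {a x : ℕ → ℝ} (ha : Tendsto a atTop atTop) {L M : ℝ → ℝ} {θ₀ r : ℝ}
    (hθ₀ : 0 < θ₀) (hr : 0 < r)
    (hpos : ∀ θ, |θ - θ₀| < r → ∀ᶠ n in atTop, 0 < laplaceSum (w n) (X n) θ)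
    (hL : ∀ θ, |θ - θ₀| < r →
      Tendsto (fun n => Real.log (laplaceSum (w n) (X n) θ) / a n) atTop (nhds (L θ)))
    (hL' : ∀ θ, |θ - θ₀| < r → HasDerivAt L (-M θ) θ)
    (hM : ∀ θ, |θ - θ₀| < r → θ₀ < θ → M θ < M θ₀) (hMc : ContinuousAt M θ₀)
    (hx : Tendsto (fun n => x n / a n) atTop (nhds (M θ₀))) :
    Tendsto (fun n => Real.log (∑ ω with X n ω ≤ x n, w n ω) / a n) atTop
      (nhds (L θ₀ + θ₀ * M θ₀)) := by
  have lower : ∀ ε, 0 < ε → ∀ᶠ n in atTop, 0 < ∑ ω with X n ω ≤ x n, w n ω ∧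
      L θ₀ + θ₀ * M θ₀ - ε < Real.log (∑ ω with X n ω ≤ x n, w n ω) / a n := by
    intro ε hε
    have hcont : ContinuousAt (fun θ => L θ + θ * (M θ - (θ - θ₀))) θ₀ :=
      (hL' θ₀ (by simpa using hr)).continuousAt.add
        (continuousAt_id.mul (hMc.sub (continuousAt_id.sub continuousAt_const)))
    have e1 : ∀ᶠ θ in nhdsWithin θ₀ (Set.Ioi θ₀),
        L θ₀ + θ₀ * M θ₀ - ε < L θ + θ * (M θ - (θ - θ₀)) :=
      mem_nhdsWithin_of_mem_nhds (hcont.eventually (lt_mem_nhds (by simpa using hε)))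
    have e2 : ∀ᶠ θ in nhdsWithin θ₀ (Set.Ioi θ₀), θ < θ₀ + r :=
      mem_nhdsWithin_of_mem_nhds (gt_mem_nhds (by linarith))
    obtain ⟨θ, ⟨h1, h2⟩, h3⟩ := ((e1.and e2).and self_mem_nhdsWithin).exists
    have h3 : θ₀ < θ := h3
    have hθr : |θ - θ₀| < r := by rw [abs_lt]; constructor <;> linarith
    have hrest : 0 < r - |θ - θ₀| := by linarith
    set y := M θ - (θ - θ₀) with hy
    have hMlt := hM θ hθr h3
    set z := (M θ + M θ₀) / 2 with hz
    obtain ⟨s, hs, hsr, hs1⟩ := exists_sub_lt_mul_of_hasDerivAt (hL' θ hθr) hrest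
      (show M θ < z by linarith)
    have hneg : HasDerivAt (fun u => L (-u)) (-(-M θ)) (-θ) := by
      have := (hL' θ hθr).scomp_of_eq (-θ) (hasDerivAt_neg (-θ)) (by simp)
      simpa [Function.comp_def] using this
    obtain ⟨t, ht, htr, ht1⟩ := exists_sub_lt_mul_of_hasDerivAt (z := -y) hneg hrest
      (by linarith)
    have ht2 : L (θ - -t) - L θ < -t * y := by
      have e : -(-θ - t) = θ - -t := by ring
      rw [e, neg_neg] at ht1
      linarith
    have hsθ : |θ - s - θ₀| < r := by
      have := abs_sub (θ - θ₀) s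
      rw [abs_of_pos hs] at this
      have e : θ - s - θ₀ = θ - θ₀ - s := by ring
      rw [e]
      linarith
    have htθ : |θ - -t - θ₀| < r := by
      have := abs_add_le (θ - θ₀) t
      rw [abs_of_pos ht] at this
      have e : θ - -t - θ₀ = θ - θ₀ + t := by ring
      rw [e]
      linarith
    have t1 := eventually_exp_mul_le ha (hpos _ hsθ) (hpos _ hθr) (hL _ hsθ) (hL _ hθr) hs1
    have t2 := eventually_exp_mul_le ha (hpos _ htθ) (hpos _ hθr) (hL _ htθ) (hL _ hθr) ht2
    have t3 := hx.eventually (lt_mem_nhds (show z < M θ₀ by linarith))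
    have t4 : Tendsto (fun n => θ * y + (Real.log (laplaceSum (w n) (X n) θ) / a n -
        Real.log 2 / a n)) atTop (nhds (θ * y + (L θ - 0))) :=
      ((hL θ hθr).sub (tendsto_const_nhds.div_atTop ha)).const_add _
    have t5 := t4.eventually (lt_mem_nhds (show L θ₀ + θ₀ * M θ₀ - ε < _ by linarith))
    filter_upwards [t1, t2, t3, t5, hpos _ hθr, ha.eventually_gt_atTop 0] with n t1 t2 t3 t5 t6 t7
    rw [lt_div_iff₀ t7] at t3
    have hle := laplaceSum_le_of_tails (hw n) (by linarith) hs ht t3.le t1 t2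
    have hp : 0 < Real.exp (θ * (y * a n)) * (laplaceSum (w n) (X n) θ / 2) := by positivity
    refine ⟨hp.trans_le hle, t5.trans_le ?_⟩
    have hlog := Real.log_le_log hp hle
    rw [Real.log_mul (Real.exp_pos _).ne' (by positivity), Real.log_exp,
      Real.log_div t6.ne' (by norm_num)] at hlog
    rw [le_div_iff₀ t7]
    have e : (θ * y + (Real.log (laplaceSum (w n) (X n) θ) / a n - Real.log 2 / a n)) * a n =
      θ * (y * a n) + (Real.log (laplaceSum (w n) (X n) θ) - Real.log 2) := by
        field_simp
    rw [e]
    exact hlog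
  rw [Metric.tendsto_nhds]
  intro ε hε
  have h0 : |θ₀ - θ₀| < r := by simpa using hr
  have u1 : Tendsto (fun n => Real.log (laplaceSum (w n) (X n) θ₀) / a n + θ₀ * (x n / a n)) atTop
      (nhds (L θ₀ + θ₀ * M θ₀)) := (hL θ₀ h0).add (hx.const_mul _)
  have u2 := u1.eventually (gt_mem_nhds (show _ < L θ₀ + θ₀ * M θ₀ + ε by linarith))
  filter_upwards [lower ε hε, u2, hpos _ h0, ha.eventually_gt_atTop 0] with n h1 h2 h3 h4
  rw [Real.dist_eq, abs_lt]
  refine ⟨by linarith [h1.2], ?_⟩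
  have hle := Real.log_le_log h1.1 (sum_filter_le_exp_mul_laplaceSum (hw n) hθ₀.le (x n))
  rw [Real.log_mul (Real.exp_pos _).ne' h3.ne', Real.log_exp] at hle
  have : Real.log (∑ ω with X n ω ≤ x n, w n ω) / a n ≤
      Real.log (laplaceSum (w n) (X n) θ₀) / a n + θ₀ * (x n / a n) := by
    rw [div_le_iff₀ h4]
    have e : (Real.log (laplaceSum (w n) (X n) θ₀) / a n + θ₀ * (x n / a n)) * a n =
      θ₀ * x n + Real.log (laplaceSum (w n) (X n) θ₀) := by field_simp; ring
    rw [e]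
    exact hle
  linarith

section Lambert

variable {W : ℝ → ℝ}

lemma sub_le_mul_exp_sub {u v : ℝ} (hu : 0 ≤ u) (huv : u ≤ v) :
    v - u ≤ v * Real.exp v - u * Real.exp u := by
  have h1 : Real.exp u ≤ Real.exp v := Real.exp_le_exp.2 huv
  have h2 : 1 ≤ Real.exp u := Real.one_le_exp hu
  nlinarith

lemma IsLambertW.abs_sub_le (hW : IsLambertW W) {x y : ℝ} (hx : 0 ≤ x) (hy : 0 ≤ y) :
    |W x - W y| ≤ |x - y| := by
  wlog h : W y ≤ W x generalizing x y
  · rw [abs_sub_comm, abs_sub_comm x]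
    exact this hy hx (not_le.1 h).le
  have := sub_le_mul_exp_sub (hW y hy).1 h
  rw [(hW x hx).2.1, (hW y hy).2.1] at this
  rw [abs_of_nonneg (by linarith)]
  exact this.trans (le_abs_self _)

lemma IsLambertW.strictMonoOn (hW : IsLambertW W) : StrictMonoOn W (Set.Ici 0) := by
  intro x hx y hy hxy
  by_contra! h
  have := sub_le_mul_exp_sub (hW y hy).1 h
  rw [(hW x hx).2.1, (hW y hy).2.1] at this
  linarith

lemma IsLambertW.continuousOn (hW : IsLambertW W) : ContinuousOn W (Set.Ici 0) := by
  refine LipschitzOnWith.continuousOn (K := 1) (LipschitzOnWith.of_dist_le_mul fun x hx y hy => ?_)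
  simpa [Real.dist_eq] using hW.abs_sub_le hx hy

lemma IsLambertW.hasDerivAt (hW : IsLambertW W) {x : ℝ} (hx : 0 < x) :
    HasDerivAt W (((1 + W x) * Real.exp (W x))⁻¹) x := by
  have h0 := (hW x hx.le).1
  refine HasDerivAt.of_local_left_inverse (f := fun w => w * Real.exp w)
    (hW.continuousOn.continuousAt (Ici_mem_nhds hx)) ?_ (by positivity) ?_
  · have := (hasDerivAt_id (W x)).mul (Real.hasDerivAt_exp (W x))
    exact this.congr_deriv (by simp only [id]; ring)
  · filter_upwards [lt_mem_nhds hx] with y hy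
    exact (hW y hy.le).2.1

/-- The inverse of `v ↦ v * exp (2 * v)`. -/
def halfW (W : ℝ → ℝ) (y : ℝ) : ℝ := W (2 * y) / 2

lemma IsLambertW.halfW_nonneg (hW : IsLambertW W) {y : ℝ} (hy : 0 ≤ y) : 0 ≤ halfW W y :=
  div_nonneg (hW (2 * y) (by positivity)).1 zero_le_two

lemma IsLambertW.halfW_mul_exp (hW : IsLambertW W) {y : ℝ} (hy : 0 ≤ y) :
    halfW W y * Real.exp (2 * halfW W y) = y := by
  have := (hW (2 * y) (by positivity)).2.1
  rw [halfW, mul_div_cancel₀ _ two_ne_zero]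
  linarith

lemma IsLambertW.halfW_eq (hW : IsLambertW W) {v : ℝ} (hv : 0 ≤ v) :
    halfW W (v * Real.exp (2 * v)) = v := by
  have := (hW (2 * (v * Real.exp (2 * v))) (by positivity)).2.2 (2 * v) (by positivity) (by ring)
  rw [halfW, ← this]
  ring

lemma IsLambertW.halfW_lt (hW : IsLambertW W) {x y : ℝ} (hx : 0 ≤ x) (hxy : x < y) :
    halfW W x < halfW W y := by
  have := hW.strictMonoOn (show 0 ≤ 2 * x by positivity) (show 0 ≤ 2 * y by linarith)
    (show 2 * x < 2 * y by linarith)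
  unfold halfW
  linarith

lemma IsLambertW.continuousOn_halfW (hW : IsLambertW W) :
    ContinuousOn (halfW W) (Set.Ici 0) := by
  refine ContinuousOn.div_const (hW.continuousOn.comp (by fun_prop) fun x hx => ?_) _
  have : (0 : ℝ) ≤ x := hx
  exact (by positivity : (0 : ℝ) ≤ 2 * x)

lemma IsLambertW.hasDerivAt_halfW (hW : IsLambertW W) {y : ℝ} (hy : 0 < y) :
    HasDerivAt (halfW W) (((1 + 2 * halfW W y) * Real.exp (2 * halfW W y))⁻¹) y := by
  have := ((hW.hasDerivAt (show 0 < 2 * y by positivity)).comp y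
    ((hasDerivAt_id y).const_mul 2)).div_const 2
  refine this.congr_deriv ?_
  simp only [halfW, mul_div_cancel₀ _ (two_ne_zero' ℝ)]
  ring

/-- The limiting normalised free energy is `c * freeEnergy W (zeta * c ^ 2)`. -/
def freeEnergy (W : ℝ → ℝ) (y : ℝ) : ℝ := Real.exp (-halfW W y) * (1 / 2 + halfW W y / 3)

lemma IsLambertW.continuousOn_freeEnergy (hW : IsLambertW W) :
    ContinuousOn (freeEnergy W) (Set.Ici 0) := by
  have := hW.continuousOn_halfW
  unfold freeEnergy
  fun_prop

lemma IsLambertW.hasDerivAt_freeEnergy (hW : IsLambertW W) {y : ℝ} (hy : 0 < y) :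
    HasDerivAt (freeEnergy W) (-(Real.exp (-(3 * halfW W y)) / 6)) y := by
  have h := hW.hasDerivAt_halfW hy
  have h0 := hW.halfW_nonneg hy.le
  have := h.neg.exp.mul ((h.div_const 3).const_add (1 / 2))
  refine this.congr_deriv ?_
  simp only [Pi.neg_apply]
  set v := halfW W y
  have e2 : Real.exp (2 * v) = (Real.exp (-v) ^ 2)⁻¹ := by
    rw [← Real.exp_nat_mul, ← Real.exp_neg]; congr 1; push_cast; ring
  have e3 : Real.exp (-(3 * v)) = Real.exp (-v) ^ 3 := by
    rw [← Real.exp_nat_mul]; congr 1; push_cast; ring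
  rw [e2, e3]
  have := (Real.exp_pos (-v)).ne'
  field_simp
  ring

lemma IsLambertW.hasDerivAt_mul_freeEnergy (hW : IsLambertW W) {zeta s : ℝ} (hz : 0 < zeta)
    (hs : 0 < s) :
    HasDerivAt (fun s => s * freeEnergy W (zeta * s ^ 2))
      (Real.exp (-halfW W (zeta * s ^ 2)) / 2) s := by
  have hy : 0 < zeta * s ^ 2 := by positivity
  have h1 := (hW.hasDerivAt_freeEnergy hy).comp s ((hasDerivAt_pow 2 s).const_mul zeta)
  refine ((hasDerivAt_id s).mul h1).congr_deriv ?_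
  have h2 := hW.halfW_mul_exp hy.le
  simp only [id, Function.comp_apply, freeEnergy]
  set v := halfW W (zeta * s ^ 2)
  have e2 : Real.exp (2 * v) = (Real.exp (-v) ^ 2)⁻¹ := by
    rw [← Real.exp_nat_mul, ← Real.exp_neg]; congr 1; push_cast; ring
  have e3 : Real.exp (-(3 * v)) = Real.exp (-v) ^ 3 := by
    rw [← Real.exp_nat_mul]; congr 1; push_cast; ring
  rw [e2] at h2
  have hne := (Real.exp_pos (-v)).ne'
  have h4 : v = zeta * s ^ 2 * Real.exp (-v) ^ 2 := by
    rw [← h2]; field_simp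
  rw [e3]
  push_cast
  linear_combination (Real.exp (-v) / 3) * h4

/-- Derivative of the free energy in the tilting parameter. -/
lemma IsLambertW.hasDerivAt_freeEnergy_tilt (hW : IsLambertW W) {c θ : ℝ} (hc : 0 < c)
    (hθ : 0 < θ) :
    HasDerivAt (fun θ => c * freeEnergy W ((1 - Real.exp (-θ)) * c ^ 2))
      (-(c ^ 3 / 6 * Real.exp (-θ) * Real.exp (-(3 * halfW W ((1 - Real.exp (-θ)) * c ^ 2))))) θ := by
  have hz : 0 < 1 - Real.exp (-θ) := by
    rw [sub_pos, Real.exp_lt_one_iff]; linarith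
  have h1 := (((hasDerivAt_neg θ).exp.const_sub 1).mul_const (c ^ 2))
  have h2 := ((hW.hasDerivAt_freeEnergy (show 0 < (1 - Real.exp (-θ)) * c ^ 2 by positivity)).comp θ
    h1).const_mul c
  refine h2.congr_deriv ?_
  ring

end Lambert

section Graph

/-- The two-element subsets of `Fin n`, i.e. the potential edges of a graph on `Fin n`. -/
abbrev EdgeSlot (n : ℕ) : Type := {e : Finset (Fin n) // e.card = 2}

/-- The edge slots inside a vertex set. -/
def slotsIn {n : ℕ} (s : Finset (Fin n)) : Finset (EdgeSlot n) := {e | e.1 ⊆ s}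

/-- The hypergraph of triangles of the complete graph, as sets of edge slots. -/
def triangleHypergraph (n : ℕ) : Finset (Finset (EdgeSlot n)) :=
  (Finset.univ.powersetCard 3).image slotsIn

/-- The edges of a graph, as edge slots. -/
def edgeSlots {n : ℕ} (G : SimpleGraph (Fin n)) : Finset (EdgeSlot n) := {e | G.IsClique e.1}

lemma mem_slotsIn {n : ℕ} {s : Finset (Fin n)} {e : EdgeSlot n} : e ∈ slotsIn s ↔ e.1 ⊆ s := by
  simp [slotsIn]

lemma mem_edgeSlots {n : ℕ} {G : SimpleGraph (Fin n)} {e : EdgeSlot n} :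
    e ∈ edgeSlots G ↔ G.IsClique e.1 := by
  simp [edgeSlots]

lemma card_slotsIn {n : ℕ} (s : Finset (Fin n)) : (slotsIn s).card = s.card.choose 2 := by
  rw [← Finset.card_powersetCard]
  refine Finset.card_bij (fun e _ => e.1) ?_ ?_ ?_
  · intro e he
    exact Finset.mem_powersetCard.2 ⟨mem_slotsIn.1 he, e.2⟩
  · intro e _ e' _ h
    exact Subtype.ext h
  · intro e he
    obtain ⟨h1, h2⟩ := Finset.mem_powersetCard.1 he
    exact ⟨⟨e, h2⟩, mem_slotsIn.2 h1, rfl⟩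

lemma subset_of_slotsIn_subset {n : ℕ} {s t : Finset (Fin n)} (hs : 2 ≤ s.card)
    (h : slotsIn s ⊆ slotsIn t) : s ⊆ t := by
  intro a ha
  obtain ⟨b, hb, hab⟩ := Finset.exists_mem_ne (by omega : 1 < s.card) a
  have : (⟨{a, b}, Finset.card_pair hab.symm⟩ : EdgeSlot n) ∈ slotsIn s := by
    rw [mem_slotsIn]
    simp [Finset.insert_subset_iff, ha, hb]
  have := mem_slotsIn.1 (h this)
  exact this (by simp)

lemma slotsIn_injOn {n : ℕ} :
    Set.InjOn (slotsIn (n := n)) (Finset.univ.powersetCard 3 : Finset (Finset (Fin n))) := by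
  intro s hs t ht h
  have h1 := (Finset.mem_powersetCard.1 (Finset.mem_coe.1 hs)).2
  have h2 := (Finset.mem_powersetCard.1 (Finset.mem_coe.1 ht)).2
  exact (subset_of_slotsIn_subset (by omega) h.subset).antisymm
    (subset_of_slotsIn_subset (by omega) h.symm.subset)

lemma card_edgeSlot (n : ℕ) : Fintype.card (EdgeSlot n) = n.choose 2 := by
  have := card_slotsIn (Finset.univ : Finset (Fin n))
  rw [Finset.card_univ, Fintype.card_fin] at this
  rw [← this, ← Finset.card_univ]
  congr 1
  ext e
  simp [mem_slotsIn]

lemma isLinearThreeGraph_triangleHypergraph (n : ℕ) :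
    IsLinearThreeGraph (triangleHypergraph n) (n - 2) := by
  have key : ∀ T ∈ triangleHypergraph n, ∃ s : Finset (Fin n), s.card = 3 ∧ slotsIn s = T := by
    intro T hT
    obtain ⟨s, hs, rfl⟩ := Finset.mem_image.1 hT
    exact ⟨s, (Finset.mem_powersetCard.1 hs).2, rfl⟩
  refine ⟨?_, ?_, ?_⟩
  · intro T hT
    obtain ⟨s, hs, rfl⟩ := key T hT
    rw [card_slotsIn, hs]
    rfl
  · intro T hT T' hT' a b hab ha hb ha' hb'
    obtain ⟨s, hs, rfl⟩ := key T hT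
    obtain ⟨t, ht, rfl⟩ := key T' hT'
    rw [mem_slotsIn] at ha hb ha' hb'
    have hcard : 3 ≤ (a.1 ∪ b.1).card := by
      by_contra! hlt
      have h1 : a.1 = a.1 ∪ b.1 :=
        Finset.eq_of_subset_of_card_le Finset.subset_union_left (by rw [a.2]; omega)
      have h2 : b.1 = a.1 ∪ b.1 :=
        Finset.eq_of_subset_of_card_le Finset.subset_union_right (by rw [b.2]; omega)
      exact hab (Subtype.ext (h1.trans h2.symm))
    have h1 := Finset.eq_of_subset_of_card_le (Finset.union_subset ha hb) (by omega)
    have h2 := Finset.eq_of_subset_of_card_le (Finset.union_subset ha' hb') (by omega)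
    rw [← h1, ← h2]
  · intro e
    have h1 : ((triangleHypergraph n).filter (e ∈ ·)).card
        = ((Finset.univ.powersetCard 3).filter (e.1 ⊆ ·)).card := by
      rw [triangleHypergraph, Finset.filter_image,
        Finset.card_image_of_injOn (slotsIn_injOn.mono (Finset.coe_subset.2 (Finset.filter_subset _ _)))]
      simp only [mem_slotsIn]
    rw [h1, Finset.card_filter_powersetCard_subset _ _ _ (Finset.subset_univ _) (by rw [e.2]; omega),
      e.2]
    simp

lemma slotsIn_subset_edgeSlots {n : ℕ} {G : SimpleGraph (Fin n)} {s : Finset (Fin n)} :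
    slotsIn s ⊆ edgeSlots G ↔ G.IsClique s := by
  constructor
  · intro h a ha b hb hab
    have : (⟨{a, b}, Finset.card_pair hab⟩ : EdgeSlot n) ∈ slotsIn s := by
      rw [mem_slotsIn]
      simp_all [Finset.insert_subset_iff]
    have := mem_edgeSlots.1 (h this)
    exact this (by simp) (by simp) hab
  · intro h e he
    exact mem_edgeSlots.2 (h.subset (by exact_mod_cast mem_slotsIn.1 he))

lemma edgeSlots_bijective (n : ℕ) : Function.Bijective (edgeSlots (n := n)) := by
  have pair : ∀ (G : SimpleGraph (Fin n)) (a b : Fin n) (hab : a ≠ b),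
      (⟨{a, b}, Finset.card_pair hab⟩ : EdgeSlot n) ∈ edgeSlots G ↔ G.Adj a b := by
    intro G a b hab
    rw [mem_edgeSlots]
    simp [hab]
  constructor
  · intro G G' h
    ext a b
    by_cases hab : a = b
    · simp [hab]
    · rw [← pair G a b hab, ← pair G' a b hab, h]
  · intro S
    refine ⟨⟨fun a b => ∃ h : a ≠ b, (⟨{a, b}, Finset.card_pair h⟩ : EdgeSlot n) ∈ S, ?_, ?_⟩, ?_⟩
    · refine ⟨fun a b ⟨h, hS⟩ => ?_⟩
      refine ⟨h.symm, ?_⟩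
      simpa only [Finset.pair_comm] using hS
    · exact ⟨fun a ⟨h, _⟩ => h rfl⟩
    · ext ⟨e, he⟩
      obtain ⟨a, b, hab, rfl⟩ := Finset.card_eq_two.1 he
      rw [pair _ a b hab]
      simp [hab]

lemma card_edgeSlots {n : ℕ} (G : SimpleGraph (Fin n)) : (edgeSlots G).card = edgeCount G := by
  rw [edgeCount, Nat.card_eq_fintype_card, ← Set.toFinset_card]
  symm
  refine Finset.card_bij (fun e he => ⟨e.toFinset, Sym2.card_toFinset_of_not_isDiag e
    (G.not_isDiag_of_mem_edgeSet (by simpa using he))⟩) ?_ ?_ ?_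
  · intro e he
    rw [mem_edgeSlots]
    induction e with
    | _ a b =>
      have : G.Adj a b := by simpa using he
      simp [Sym2.toFinset_mk_eq, this]
  · intro e _ e' _ h
    have h := Subtype.ext_iff.1 h
    refine Sym2.ext fun x => ?_
    have := Finset.ext_iff.1 h x
    simpa using this
  · rintro ⟨e, he⟩ h
    rw [mem_edgeSlots] at h
    obtain ⟨a, b, hab, rfl⟩ := Finset.card_eq_two.1 he
    refine ⟨s(a, b), ?_, ?_⟩
    · simpa using h (by simp) (by simp) hab
    · simp [Sym2.toFinset_mk_eq]

lemma card_filter_triangleHypergraph {n : ℕ} (G : SimpleGraph (Fin n)) :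
    ((triangleHypergraph n).filter (· ⊆ edgeSlots G)).card = triCount G := by
  rw [triangleHypergraph, Finset.filter_image,
    Finset.card_image_of_injOn (slotsIn_injOn.mono (Finset.coe_subset.2 (Finset.filter_subset _ _))),
    triCount,
    Nat.card_eq_fintype_card, Fintype.card_subtype]
  congr 1
  ext s
  simp [slotsIn_subset_edgeSlots, SimpleGraph.isNClique_iff, and_comm]

lemma sum_pow_edgeCount_mul_pow_triCount (n : ℕ) (lam zeta : ℝ) :
    ∑ G : SimpleGraph (Fin n), lam ^ edgeCount G * (1 - zeta) ^ triCount G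
      = pinnedZ lam zeta (triangleHypergraph n) ∅ := by
  rw [pinnedZ_empty]
  refine Fintype.sum_bijective _ (edgeSlots_bijective n) _ _ fun G => ?_
  rw [card_edgeSlots, card_filter_triangleHypergraph]

end Graph

section TiltParameter

/-- `t` is the ratio of the edge density of the graph conditioned on having at most `η` times the
expected number of triangles at density `c / √n` to its unconditioned edge density. -/
structure IsEdgeRatio (η c t : ℝ) : Prop where
  pos : 0 < t
  lt_one : t < 1
  lt_pow : η < t ^ 3
  eq : c ^ 2 * (t ^ 2 - η / t) = -Real.log t

lemma sq_sub_div_strictMono {η s t : ℝ} (hη : 0 < η) (hs : 0 < s) (hst : s < t) :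
    s ^ 2 - η / s < t ^ 2 - η / t := by
  have h1 : s ^ 2 < t ^ 2 := by gcongr
  have h2 : η / t < η / s := by gcongr
  linarith

lemma sq_sub_div_pos {η t : ℝ} (ht : 0 < t) (h : η < t ^ 3) : 0 < t ^ 2 - η / t := by
  rw [sub_pos, div_lt_iff₀ ht]
  linarith [pow_succ t 2]

lemma exists_isEdgeRatio {η c : ℝ} (hη : 0 < η) (hη1 : η < 1) (hc : 0 < c) :
    ∃ t, IsEdgeRatio η c t := by
  set a := η ^ ((1 : ℝ) / 3) with ha
  have ha0 : 0 < a := Real.rpow_pos_of_pos hη _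
  have ha1 : a < 1 := Real.rpow_lt_one hη.le hη1 (by norm_num)
  have ha3 : a ^ 3 = η := by
    rw [ha, ← Real.rpow_natCast, ← Real.rpow_mul hη.le]; norm_num
  have hcont : ContinuousOn (fun t => c ^ 2 * (t ^ 2 - η / t) + Real.log t) (Set.Icc a 1) := by
    refine ContinuousOn.add (ContinuousOn.mul continuousOn_const (ContinuousOn.sub (by fun_prop)
      (ContinuousOn.div continuousOn_const continuousOn_id ?_))) (Real.continuousOn_log.mono ?_)
    · exact fun x hx => (ha0.trans_le hx.1).ne'
    · exact fun x hx => (ha0.trans_le hx.1).ne'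
  have hlow : c ^ 2 * (a ^ 2 - η / a) + Real.log a < 0 := by
    have : a ^ 2 - η / a = 0 := by rw [← ha3]; field_simp; ring
    rw [this]
    linarith [Real.log_neg ha0 ha1]
  have hhigh : 0 < c ^ 2 * ((1 : ℝ) ^ 2 - η / 1) + Real.log 1 := by
    rw [Real.log_one]
    have : 0 < 1 - η := by linarith
    have : 0 < c ^ 2 * (1 - η) := by positivity
    linarith
  obtain ⟨t, ht, h⟩ := intermediate_value_Ioo ha1.le hcont ⟨hlow, hhigh⟩
  refine ⟨t, ha0.trans ht.1, ht.2, ?_, ?_⟩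
  · rw [← ha3]
    have := ht.1
    gcongr
  · simp only at h
    linarith

lemma IsEdgeRatio.unique {η c s t : ℝ} (hη : 0 < η) (hs : IsEdgeRatio η c s)
    (ht : IsEdgeRatio η c t) : s = t := by
  wlog hst : s < t generalizing s t
  · rcases (not_lt.1 hst).eq_or_lt with h | h
    · exact h.symm
    · exact (this ht hs h).symm
  have h1 := sq_sub_div_strictMono hη hs.pos hst
  have h2 := Real.log_lt_log hs.pos hst
  have h3 := mul_le_mul_of_nonneg_left h1.le (sq_nonneg c)
  rw [hs.eq, ht.eq] at h3
  linarith

/-- If `t c` is the edge ratio at density `c / √n`, then `t` is real-analytic. -/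
lemma analyticAt_of_isEdgeRatio {η : ℝ} (hη : 0 < η) {t : ℝ → ℝ}
    (ht : ∀ c, 0 < c → IsEdgeRatio η c (t c)) {c : ℝ} (hc : 0 < c) : AnalyticAt ℝ t c := by
  set h : ℝ → ℝ := fun s => -Real.log s / (s ^ 2 - η / s) with hh
  have ht0 := ht c hc
  have hpos := sq_sub_div_pos ht0.pos ht0.lt_pow
  have hh0 : h (t c) = c ^ 2 := by
    rw [hh]
    simp only
    rw [← ht0.eq, mul_div_cancel_right₀ _ hpos.ne']
  have han : AnalyticAt ℝ h (t c) := by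
    refine AnalyticAt.div (analyticAt_log ht0.pos).neg ?_ hpos.ne'
    exact (analyticAt_id.pow 2).sub (analyticAt_const.div analyticAt_id ht0.pos.ne')
  have hder : deriv h (t c) ≠ 0 := by
    have h1 : HasDerivAt h _ (t c) := (Real.hasDerivAt_log ht0.pos.ne').neg.div
      ((hasDerivAt_pow 2 (t c)).sub ((hasDerivAt_id (t c)).fun_inv ht0.pos.ne' |>.const_mul η))
      (by simpa only [Pi.sub_apply, ← div_eq_mul_inv, id] using hpos.ne')
    rw [h1.deriv]
    have hlog := Real.log_neg ht0.pos ht0.lt_one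
    have ht00 := ht0.pos
    refine (div_neg_of_neg_of_pos ?_ ?_).ne
    · simp only [Pi.neg_apply, id]
      have e1 : 0 < (t c)⁻¹ * (t c ^ 2 - η / t c) := by positivity
      have e2 : 0 < 2 * t c - η * (-1 / t c ^ 2) := by
        have : 0 < η / t c ^ 2 := by positivity
        have e : η * (-1 / t c ^ 2) = -(η / t c ^ 2) := by ring
        rw [e]
        linarith
      have e3 := mul_neg_of_neg_of_pos hlog e2
      push_cast
      linarith
    · exact pow_pos (by simpa only [Pi.sub_apply, ← div_eq_mul_inv, id] using hpos) 2
  have hcomp : AnalyticAt ℝ ((fun y => t (Real.sqrt y)) ∘ h) (t c) := by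
    refine analyticAt_id.congr ?_
    have hcub : ∀ᶠ s in nhds (t c), η < s ^ 3 :=
      (continuous_pow 3).continuousAt.eventually_const_lt ht0.lt_pow
    filter_upwards [lt_mem_nhds ht0.pos, gt_mem_nhds ht0.lt_one, hcub] with s hs0 hs1 hs3
    have hp := sq_sub_div_pos hs0 hs3
    have hhs : 0 < h s := div_pos (by linarith [Real.log_neg hs0 hs1]) hp
    refine IsEdgeRatio.unique hη ⟨hs0, hs1, hs3, ?_⟩ (ht _ (Real.sqrt_pos.2 hhs))
    rw [Real.sq_sqrt hhs.le]
    exact div_mul_cancel₀ _ hp.ne'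
  rw [analyticAt_comp_iff_of_deriv_ne_zero han hder, hh0] at hcomp
  refine (hcomp.comp_of_eq (analyticAt_id.pow 2) (by simp)).congr ?_
  filter_upwards [lt_mem_nhds hc] with x hx
  simp [Real.sqrt_sq hx.le]

lemma IsLambertW.etaStar_eq {W : ℝ → ℝ} (hW : IsLambertW W) :
    etaStar W = Real.exp (-(W (2 / Real.exp 1) / 2)) ^ 3 := by
  have h := (hW (2 / Real.exp 1) (by positivity)).2.1
  set w := W (2 / Real.exp 1)
  have : w / (2 / Real.exp 1) = Real.exp (-w) := by
    rw [div_eq_iff (by positivity), ← h, Real.exp_neg]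
    field_simp
  rw [etaStar, this, ← Real.exp_mul, ← Real.exp_nat_mul]
  congr 1
  push_cast
  ring

lemma IsEdgeRatio.two_mul_lt_one {W : ℝ → ℝ} (hW : IsLambertW W) {η c t : ℝ}
    (hη : etaStar W ≤ η) (ht : IsEdgeRatio η c t) : 2 * (1 - η / t ^ 3) * c ^ 2 < 1 := by
  have h := (hW (2 / Real.exp 1) (by positivity)).2.1
  rw [hW.etaStar_eq] at hη
  set w := W (2 / Real.exp 1)
  have h1 : Real.exp (-(w / 2)) < t := lt_of_pow_lt_pow_left₀ 3 ht.pos.le (hη.trans_lt ht.lt_pow)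
  have h2 : -(w / 2) < Real.log t := (Real.lt_log_iff_exp_lt ht.pos).2 h1
  have h3 : (1 - η / t ^ 3) * c ^ 2 = -Real.log t / t ^ 2 := by
    rw [← ht.eq]
    have := ht.pos
    field_simp
  have h4 : Real.exp (-w) < t ^ 2 := by
    calc Real.exp (-w) = Real.exp (-(w / 2)) ^ 2 := by
          rw [← Real.exp_nat_mul]; congr 1; push_cast; ring
      _ < t ^ 2 := by gcongr
  have h5 := Real.log_neg ht.pos ht.lt_one
  have h6 : w = 2 / Real.exp 1 * Real.exp (-w) := by
    rw [← h, mul_assoc, ← Real.exp_add]; simp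
  have h7 : 2 / Real.exp 1 < 1 := by
    rw [div_lt_one (Real.exp_pos 1)]
    linarith [Real.exp_one_gt_d9]
  have h8 : 0 < Real.exp (-w) := Real.exp_pos _
  rw [mul_assoc, h3, ← mul_div_assoc, div_lt_one (pow_pos ht.pos 2)]
  nlinarith

end TiltParameter

section Asymptotics

lemma tendsto_choose_div_pow (k : ℕ) :
    Tendsto (fun n : ℕ => (n.choose k : ℝ) / (n : ℝ) ^ k) atTop (nhds (1 / k.factorial)) := by
  have h : Tendsto (fun n : ℕ => (n : ℝ) * (fun n : ℕ => ((n : ℝ))⁻¹) n) atTop (nhds 1) := by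
    refine tendsto_const_nhds.congr' ?_
    filter_upwards [eventually_gt_atTop 0] with n hn
    have : (n : ℝ) ≠ 0 := by exact_mod_cast hn.ne'
    exact (mul_inv_cancel₀ this).symm
  simpa [div_eq_mul_inv] using ProbabilityTheory.tendsto_choose_mul_pow_atTop k h

lemma tendsto_sqrt_natCast_atTop : Tendsto (fun n : ℕ => √(n : ℝ)) atTop atTop :=
  Real.tendsto_sqrt_atTop.comp tendsto_natCast_atTop_atTop

lemma natCast_rpow_three_halves (n : ℕ) : (n : ℝ) ^ ((3 : ℝ) / 2) = n * √(n : ℝ) := by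
  rw [Real.sqrt_eq_rpow, show (3 : ℝ) / 2 = 1 + 1 / 2 by norm_num,
    Real.rpow_add_of_nonneg (Nat.cast_nonneg n) (by norm_num) (by norm_num), Real.rpow_one]

lemma tendsto_sqrt_sub_two_div_sqrt :
    Tendsto (fun n : ℕ => √((n - 2 : ℕ) : ℝ) / √(n : ℝ)) atTop (nhds 1) := by
  have h : Tendsto (fun n : ℕ => √(1 - 2 / (n : ℝ))) atTop (nhds √(1 - 0)) :=
    (tendsto_const_nhds.sub (tendsto_const_div_atTop_nhds_zero_nat 2)).sqrt
  rw [sub_zero, Real.sqrt_one] at h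
  refine h.congr' ?_
  filter_upwards [eventually_ge_atTop 2] with n hn
  have : (n : ℝ) ≠ 0 := by positivity
  rw [← Real.sqrt_div (Nat.cast_nonneg _), Nat.cast_sub hn, sub_div, div_self this]
  norm_num

lemma tendsto_div_sqrt_natCast (c : ℝ) : Tendsto (fun n : ℕ => c / √(n : ℝ)) atTop (nhds 0) :=
  tendsto_sqrt_natCast_atTop.const_div_atTop c

lemma eventually_div_sqrt_lt_one (c : ℝ) : ∀ᶠ n : ℕ in atTop, c / √(n : ℝ) < 1 :=
  (tendsto_div_sqrt_natCast c).eventually_lt_const one_pos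

lemma tendsto_choose_two_mul_log (c : ℝ) :
    Tendsto (fun n : ℕ => (n.choose 2 * Real.log (1 - c / √(n : ℝ))) / (n : ℝ) ^ ((3 : ℝ) / 2))
      atTop (nhds (-(c / 2))) := by
  have h := (tendsto_choose_div_pow 2).mul
    ((Real.tendsto_mul_log_one_add_div_atTop (-c)).comp tendsto_sqrt_natCast_atTop)
  have e : 1 / ((2 : ℕ).factorial : ℝ) * -c = -(c / 2) := by norm_num; ring
  rw [e] at h
  refine h.congr' ?_
  filter_upwards [eventually_gt_atTop 0] with n hn
  have hn0 : (0 : ℝ) < n := by exact_mod_cast hn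
  have hs : √(n : ℝ) ^ 2 = n := Real.sq_sqrt hn0.le
  have hs0 : 0 < √(n : ℝ) := Real.sqrt_pos.2 hn0
  rw [natCast_rpow_three_halves]
  simp only [Function.comp_apply, neg_div, ← sub_eq_add_neg]
  generalize Real.log _ = l
  set s := √(n : ℝ)
  rw [← hs]
  field_simp

lemma tendsto_choose_two_div_sqrt_sub_two :
    Tendsto (fun n : ℕ => (n.choose 2 : ℝ) / √((n - 2 : ℕ) : ℝ) / (n : ℝ) ^ ((3 : ℝ) / 2))
      atTop (nhds (1 / 2)) := by
  have h := (tendsto_choose_div_pow 2).mul (tendsto_sqrt_sub_two_div_sqrt.inv₀ one_ne_zero)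
  have e : 1 / ((2 : ℕ).factorial : ℝ) * 1⁻¹ = 1 / 2 := by norm_num
  rw [e] at h
  refine h.congr' ?_
  filter_upwards [eventually_gt_atTop 2] with n hn
  have hn0 : (0 : ℝ) < n := by positivity
  have hs : √(n : ℝ) ^ 2 = n := Real.sq_sqrt hn0.le
  have hs0 : 0 < √(n : ℝ) := Real.sqrt_pos.2 hn0
  have hd0 : 0 < √((n - 2 : ℕ) : ℝ) := Real.sqrt_pos.2 (by exact_mod_cast Nat.sub_pos_of_lt hn)
  rw [natCast_rpow_three_halves]
  generalize √((n - 2 : ℕ) : ℝ) = d at hd0 ⊢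
  set s := √(n : ℝ)
  rw [← hs]
  field_simp

lemma tendsto_odds_mul_sqrt (c : ℝ) :
    Tendsto (fun n : ℕ => c / √(n : ℝ) / (1 - c / √(n : ℝ)) * √((n - 2 : ℕ) : ℝ))
      atTop (nhds c) := by
  have h := (tendsto_sqrt_sub_two_div_sqrt.const_mul c).div
    (tendsto_const_nhds.sub (tendsto_div_sqrt_natCast c)) (show (1 : ℝ) - 0 ≠ 0 by norm_num)
  simp only [mul_one, sub_zero, div_one] at h
  refine h.congr fun n => ?_
  simp only [Pi.div_apply]
  ring

lemma tendsto_choose_three_mul (η c : ℝ) :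
    Tendsto (fun n : ℕ => η * (n.choose 3 : ℝ) * (c / √(n : ℝ)) ^ 3 / (n : ℝ) ^ ((3 : ℝ) / 2))
      atTop (nhds (η * (c ^ 3 / 6))) := by
  have h := ((tendsto_choose_div_pow 3).mul_const (c ^ 3)).const_mul η
  have e : 1 / ((3 : ℕ).factorial : ℝ) * c ^ 3 = c ^ 3 / 6 := by norm_num [Nat.factorial]; ring
  rw [e] at h
  refine h.congr' ?_
  filter_upwards [eventually_gt_atTop 0] with n hn
  have hn0 : (0 : ℝ) < n := by exact_mod_cast hn
  have hs : √(n : ℝ) ^ 2 = n := Real.sq_sqrt hn0.le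
  have hs0 : 0 < √(n : ℝ) := Real.sqrt_pos.2 hn0
  rw [natCast_rpow_three_halves]
  set s := √(n : ℝ)
  rw [← hs]
  field_simp

lemma tendsto_natCast_rpow_three_halves :
    Tendsto (fun n : ℕ => (n : ℝ) ^ ((3 : ℝ) / 2)) atTop atTop :=
  (tendsto_rpow_atTop (by norm_num)).comp tendsto_natCast_atTop_atTop

/-- The free energy of the triangle Gibbs measure at edge activity of order `n ^ (-1 / 2)`. -/
lemma IsLambertW.tendsto_log_pinnedZ_triangleHypergraph {W : ℝ → ℝ} (hW : IsLambertW W)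
    {zeta c : ℝ} (hz0 : 0 < zeta) (hz : zeta < 1) (hc : 0 < c) (hzc : 2 * zeta * c ^ 2 < 1)
    {lam : ℕ → ℝ} (hlam : Tendsto (fun n => lam n * √((n - 2 : ℕ) : ℝ)) atTop (nhds c)) :
    Tendsto (fun n => Real.log (pinnedZ (lam n) zeta (triangleHypergraph n) ∅) /
      (n : ℝ) ^ ((3 : ℝ) / 2)) atTop (nhds (c * freeEnergy W (zeta * c ^ 2))) := by
  set Q : ℝ → ℝ := fun s => s * Real.exp (-halfW W (zeta * s ^ 2)) with hQ
  set F : ℝ → ℝ := fun s => 2 * (s * freeEnergy W (zeta * s ^ 2)) with hF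
  have hdiv : ∀ s, 0 < s → Q s / s = Real.exp (-halfW W (zeta * s ^ 2)) := by
    intro s hs
    rw [hQ]
    field_simp
  have hmaps : ∀ s : ℝ, zeta * s ^ 2 ∈ Set.Ici (0 : ℝ) := fun s =>
    (by positivity : (0 : ℝ) ≤ zeta * s ^ 2)
  have hcontW : Continuous fun s => halfW W (zeta * s ^ 2) :=
    hW.continuousOn_halfW.comp_continuous (by fun_prop) hmaps
  have hcontF : Continuous fun s => freeEnergy W (zeta * s ^ 2) :=
    hW.continuousOn_freeEnergy.comp_continuous (by fun_prop) hmaps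
  have key := tendsto_log_pinnedZ_div (E := EdgeSlot) (𝓗 := triangleHypergraph)
    (d := fun n => n - 2) (Q := Q) (F := F) (tendsto_sub_atTop_nat 2)
    ?_ (Eventually.of_forall isLinearThreeGraph_triangleHypergraph) hz0.le hz hc hzc ?_ ?_ ?_ ?_ ?_ ?_
    hlam
  · have h := key.mul tendsto_choose_two_div_sqrt_sub_two
    have e : F c * (1 / 2) = c * freeEnergy W (zeta * c ^ 2) := by rw [hF]; ring
    rw [e] at h
    refine h.congr' ?_
    filter_upwards [eventually_gt_atTop 2] with n hn
    have hd0 : 0 < √((n - 2 : ℕ) : ℝ) := Real.sqrt_pos.2 (by exact_mod_cast Nat.sub_pos_of_lt hn)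
    have hN : (0 : ℝ) < n.choose 2 := by exact_mod_cast Nat.choose_pos hn.le
    rw [mul_div_cancel_right₀ _ hd0.ne', card_edgeSlot]
    generalize (n : ℝ) ^ ((3 : ℝ) / 2) = y
    field_simp
  · filter_upwards [eventually_ge_atTop 2] with n hn
    rw [← Fintype.card_pos_iff, card_edgeSlot]
    exact Nat.choose_pos hn
  · intro s hs
    rw [hQ]
    positivity
  · intro s hs
    have h1 := hW.halfW_mul_exp (hmaps s)
    have h2 : zeta * Q s ^ 2 = halfW W (zeta * s ^ 2) := by
      have e : Real.exp (2 * halfW W (zeta * s ^ 2))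
          = (Real.exp (-halfW W (zeta * s ^ 2)) ^ 2)⁻¹ := by
        rw [← Real.exp_nat_mul, ← Real.exp_neg]; congr 1; push_cast; ring
      rw [e, mul_inv_eq_iff_eq_mul₀ (by positivity)] at h1
      rw [hQ]
      simp only
      linarith
    rw [h2]
  · exact (continuous_const.mul (continuous_id.mul hcontF)).continuousOn
  · simp [hF]
  · intro s hs
    rw [hdiv s hs.1]
    exact ((hW.hasDerivAt_mul_freeEnergy hz0 hs.1).const_mul 2).congr_deriv (by ring)
  · refine IntervalIntegrable.congr ?_
      ((Real.continuous_exp.comp hcontW.neg).intervalIntegrable 0 c)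
    intro s hs
    rw [Set.uIoc_of_le hc.le] at hs
    exact (hdiv s hs.1).symm

end Asymptotics

section LaplaceTransform

/-- The probability of a graph under the Erdős–Rényi random graph. -/
def erWeight (n : ℕ) (p : ℝ) (G : SimpleGraph (Fin n)) : ℝ :=
  p ^ edgeCount G * (1 - p) ^ (n.choose 2 - edgeCount G)

lemma edgeCount_le {n : ℕ} (G : SimpleGraph (Fin n)) : edgeCount G ≤ n.choose 2 := by
  rw [← card_edgeSlots, ← card_edgeSlot]
  exact Finset.card_le_univ _

lemma laplaceSum_erWeight {n : ℕ} {p : ℝ} (hp : p < 1) (θ : ℝ) :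
    laplaceSum (erWeight n p) (fun G => (triCount G : ℝ)) θ
      = (1 - p) ^ n.choose 2 *
        pinnedZ (p / (1 - p)) (1 - Real.exp (-θ)) (triangleHypergraph n) ∅ := by
  have h1 : (1 - p) ≠ 0 := by linarith
  rw [← sum_pow_edgeCount_mul_pow_triCount, laplaceSum, Finset.mul_sum]
  refine Finset.sum_congr rfl fun G _ => ?_
  rw [erWeight, ← Nat.sub_add_cancel (edgeCount_le G), Nat.add_sub_cancel, pow_add, div_pow,
    sub_sub_cancel, ← Real.exp_nat_mul]
  have : (triCount G : ℝ) * -θ = -θ * triCount G := mul_comm _ _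
  rw [this]
  field_simp

lemma empty_notMem_triangleHypergraph (n : ℕ) : ∅ ∉ triangleHypergraph n :=
  fun h => by simpa using (isLinearThreeGraph_triangleHypergraph n).card_eq _ h

end LaplaceTransform

section LowerTail

lemma eventually_min_one_div_sqrt (c : ℝ) :
    ∀ᶠ n : ℕ in atTop, min 1 (c / √(n : ℝ)) = c / √(n : ℝ) :=
  (eventually_div_sqrt_lt_one c).mono fun _ hn => min_eq_right hn.le

lemma eventually_laplaceSum_erWeight_pos {c : ℝ} (hc : 0 < c) (θ : ℝ) :
    ∀ᶠ n : ℕ in atTop, 0 < laplaceSum (erWeight n (min 1 (c / √(n : ℝ))))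
      (fun G => (triCount G : ℝ)) θ := by
  filter_upwards [eventually_div_sqrt_lt_one c] with n hn
  have h1 : 0 < 1 - c / √(n : ℝ) := by linarith
  rw [min_eq_right hn.le, laplaceSum_erWeight hn]
  refine mul_pos (pow_pos h1 _) (pinnedZ_empty_pos (by positivity) ?_
    (empty_notMem_triangleHypergraph n))
  linarith [Real.exp_pos (-θ)]

lemma IsLambertW.tendsto_log_laplaceSum {W : ℝ → ℝ} (hW : IsLambertW W) {c θ : ℝ} (hc : 0 < c)
    (hθ : 0 < θ) (h : 2 * (1 - Real.exp (-θ)) * c ^ 2 < 1) :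
    Tendsto (fun n : ℕ => Real.log (laplaceSum (erWeight n (min 1 (c / √(n : ℝ))))
      (fun G => (triCount G : ℝ)) θ) / (n : ℝ) ^ ((3 : ℝ) / 2)) atTop
      (nhds (-(c / 2) + c * freeEnergy W ((1 - Real.exp (-θ)) * c ^ 2))) := by
  have hz0 : 0 < 1 - Real.exp (-θ) := by
    rw [sub_pos, Real.exp_lt_one_iff]; linarith
  have hz1 : 1 - Real.exp (-θ) < 1 := by linarith [Real.exp_pos (-θ)]
  refine ((tendsto_choose_two_mul_log c).add (hW.tendsto_log_pinnedZ_triangleHypergraph hz0 hz1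
    hc h (tendsto_odds_mul_sqrt c))).congr' ?_
  filter_upwards [eventually_div_sqrt_lt_one c] with n hn
  have h1 : 0 < 1 - c / √(n : ℝ) := by linarith
  rw [min_eq_right hn.le, laplaceSum_erWeight hn, Real.log_mul (pow_pos h1 _).ne'
    (pinnedZ_empty_pos (by positivity) hz1 (empty_notMem_triangleHypergraph n)).ne', Real.log_pow,
    add_div]

/-- The lower tail rate at density `c / √n` in terms of the edge ratio `t`. -/
def lowerTailRate (η c t : ℝ) : ℝ :=
  -(c / 2) + c * (t * (1 / 2 + -Real.log t / 3)) +
    (3 * Real.log t - Real.log η) * (η * (c ^ 3 / 6))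

lemma IsLambertW.tendsto_log_erProb {W : ℝ → ℝ} (hW : IsLambertW W) {η c t : ℝ}
    (hη0 : 0 < η) (hη : etaStar W ≤ η) (hc : 0 < c) (ht : IsEdgeRatio η c t) :
    Tendsto (fun n : ℕ => Real.log (erProb n (min 1 (c / √(n : ℝ)))
      {G | (triCount G : ℝ) ≤ η * (n.choose 3 : ℝ) * (min 1 (c / √(n : ℝ))) ^ 3}) /
        (n : ℝ) ^ ((3 : ℝ) / 2)) atTop (nhds (lowerTailRate η c t)) := by
  have ht0 := ht.pos
  have ht3 : 0 < t ^ 3 := pow_pos ht0 3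
  set θ₀ := 3 * Real.log t - Real.log η with hθ₀
  have hexp : Real.exp (-θ₀) = η / t ^ 3 := by
    rw [hθ₀, neg_sub, Real.exp_sub, Real.exp_log hη0, show (3 : ℝ) * Real.log t = Real.log (t ^ 3) by
      rw [Real.log_pow]; norm_num, Real.exp_log ht3]
  have hθ₀pos : 0 < θ₀ := by
    have := (div_lt_one ht3).2 ht.lt_pow
    rw [← hexp, Real.exp_lt_one_iff] at this
    linarith
  have hlog := Real.log_neg ht0 ht.lt_one
  have hV : halfW W ((1 - Real.exp (-θ₀)) * c ^ 2) = -Real.log t := by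
    rw [← hW.halfW_eq (show 0 ≤ -Real.log t by linarith)]
    congr 1
    have : Real.exp (2 * -Real.log t) = (t ^ 2)⁻¹ := by
      rw [mul_neg, Real.exp_neg, show (2 : ℝ) * Real.log t = Real.log (t ^ 2) by
        rw [Real.log_pow]; norm_num, Real.exp_log (by positivity)]
    rw [this, hexp, ← ht.eq]
    field_simp
  have hcond : 2 * (1 - Real.exp (-θ₀)) * c ^ 2 < 1 := by
    rw [hexp]
    exact ht.two_mul_lt_one hW hη
  have hnhds : ∀ᶠ θ in nhds θ₀, 0 < θ ∧ 2 * (1 - Real.exp (-θ)) * c ^ 2 < 1 := by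
    refine (lt_mem_nhds hθ₀pos).and ?_
    have : ContinuousAt (fun θ => 2 * (1 - Real.exp (-θ)) * c ^ 2) θ₀ := by fun_prop
    exact this.eventually_lt_const hcond
  obtain ⟨r, hr, hball⟩ := Metric.eventually_nhds_iff.1 hnhds
  simp only [Real.dist_eq] at hball
  set M : ℝ → ℝ := fun θ => c ^ 3 / 6 * Real.exp (-θ) *
    Real.exp (-(3 * halfW W ((1 - Real.exp (-θ)) * c ^ 2))) with hM
  have hMθ₀ : M θ₀ = η * (c ^ 3 / 6) := by
    have : Real.exp (-(3 * -Real.log t)) = t ^ 3 := by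
      rw [show -(3 * -Real.log t) = Real.log (t ^ 3) by rw [Real.log_pow]; push_cast; ring,
        Real.exp_log ht3]
    rw [hM]
    simp only
    rw [hV, hexp, this]
    field_simp
  have hy : ∀ θ, 0 < θ → 0 < (1 - Real.exp (-θ)) * c ^ 2 := by
    intro θ hθ
    have : 0 < 1 - Real.exp (-θ) := by
      rw [sub_pos, Real.exp_lt_one_iff]; linarith
    positivity
  have hp : ∀ n : ℕ, 0 ≤ min 1 (c / √(n : ℝ)) := fun n => le_min zero_le_one (by positivity)
  have key := tendsto_log_sum_filter_le (Ω := fun n => SimpleGraph (Fin n))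
    (w := fun n => erWeight n (min 1 (c / √(n : ℝ)))) (X := fun n G => (triCount G : ℝ))
    (a := fun n : ℕ => (n : ℝ) ^ ((3 : ℝ) / 2))
    (x := fun n => η * (n.choose 3 : ℝ) * (min 1 (c / √(n : ℝ))) ^ 3)
    (L := fun θ => -(c / 2) + c * freeEnergy W ((1 - Real.exp (-θ)) * c ^ 2)) (M := M)
    (fun n G => mul_nonneg (pow_nonneg (hp n) _) (pow_nonneg (sub_nonneg.2 (min_le_left _ _)) _))
    tendsto_natCast_rpow_three_halves hθ₀pos hr
    (fun θ _ => eventually_laplaceSum_erWeight_pos hc θ)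
    (fun θ hθ => hW.tendsto_log_laplaceSum hc (hball hθ).1 (hball hθ).2)
    (fun θ hθ => (hW.hasDerivAt_freeEnergy_tilt hc (hball hθ).1).const_add _) ?_ ?_ ?_
  · have e : -(c / 2) + c * freeEnergy W ((1 - Real.exp (-θ₀)) * c ^ 2) + θ₀ * M θ₀
        = lowerTailRate η c t := by
      rw [freeEnergy, hV, hMθ₀, neg_neg, Real.exp_log ht0, lowerTailRate]
    rw [← e]
    refine key.congr fun n => ?_
    rw [erProb, Finset.sum_filter]
    rfl
  · intro θ _ hlt
    have h1 : Real.exp (-θ) < Real.exp (-θ₀) := Real.exp_lt_exp.2 (by linarith)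
    have h2 := hW.halfW_lt (hy θ₀ hθ₀pos).le (show (1 - Real.exp (-θ₀)) * c ^ 2 <
      (1 - Real.exp (-θ)) * c ^ 2 by gcongr)
    rw [hM]
    simp only
    gcongr
  · have h1 : ContinuousAt (fun θ => halfW W ((1 - Real.exp (-θ)) * c ^ 2)) θ₀ :=
      (hW.hasDerivAt_halfW (hy θ₀ hθ₀pos)).continuousAt.comp
        (f := fun θ => (1 - Real.exp (-θ)) * c ^ 2) (by fun_prop)
    fun_prop
  · rw [hMθ₀]
    refine (tendsto_choose_three_mul η c).congr' ?_
    filter_upwards [eventually_min_one_div_sqrt c] with n hn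
    rw [hn]

lemma analyticAt_lowerTailRate {η : ℝ} {t : ℝ → ℝ} {c : ℝ} (ht : AnalyticAt ℝ t c)
    (h0 : 0 < t c) : AnalyticAt ℝ (fun c => lowerTailRate η c (t c)) c := by
  have hlog : AnalyticAt ℝ (fun c => Real.log (t c)) c := ht.log h0
  unfold lowerTailRate
  fun_prop (disch := norm_num)

end LowerTail

/-- **Corollary (no phase transition for moderate lower tails, `η ≥ η*`).**
For every `c > 0` the lower-tail rate function `φ_η(c)` exists as a limit, and
`φ_η` is real-analytic at every point of `(0,∞)`. -/
theorem no_phase_transition_moderate_eta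
    (W : ℝ → ℝ) (hW : IsLambertW W)
    (η : ℝ) (hη : etaStar W ≤ η) (hη1 : η < 1) :
    ∃ φ : ℝ → ℝ,
      (∀ c : ℝ, 0 < c →
        Tendsto (fun n : ℕ =>
          Real.log (erProb n (min 1 (c / Real.sqrt n))
            {G | (triCount G : ℝ) ≤ η * (n.choose 3 : ℝ) * (min 1 (c / Real.sqrt n)) ^ 3}) /
            (n : ℝ) ^ ((3 : ℝ) / 2)) atTop (nhds (φ c))) ∧
      (∀ c : ℝ, 0 < c → AnalyticAt ℝ φ c) := by
  have hη0 : 0 < η := by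
    refine lt_of_lt_of_le ?_ hη
    rw [hW.etaStar_eq]
    positivity
  have hex : ∀ c, ∃ t, 0 < c → IsEdgeRatio η c t := fun c => by
    by_cases hc : 0 < c
    · exact (exists_isEdgeRatio hη0 hη1 hc).imp fun _ h _ => h
    · exact ⟨0, fun h => absurd h hc⟩
  choose t ht using hex
  exact ⟨fun c => lowerTailRate η c (t c), fun c hc => hW.tendsto_log_erProb hη0 hη hc (ht c hc),
    fun c hc => analyticAt_lowerTailRate (analyticAt_of_isEdgeRatio hη0 ht hc) (ht c hc).pos⟩
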